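/- Let D ⋐ ℂ^m be a bounded symmetric domain with canonical Kähler form ω_D, and let (X, g_X) be a projective manifold admitting a holomorphic isometric embedding into a product (ℙ^{N₁}, μ₁ g_{FS}) × ⋯ × (ℙ^{N_l}, μ_l g_{FS}) of Fubini–Study spaces (μ_j > 0). Then for every integer 1 ≤ p ≤ min{m, dim_ℂ X} and every real λ > 0 there exists no germ of holomorphic map F : (D; x₀) → (X; F(x₀)) with F^* ω_X^p = λ ω_D^p. -/

import Mathlib

open scoped Classical ComplexOrder
open Complex Set

noncomputable section

/-- Holomorphic Jacobian entry ∂F_i/∂w_l at w. -/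
def Jac {m : ℕ} {ι : Type*} (F : (Fin m → ℂ) → ι → ℂ) (w : Fin m → ℂ) (i : ι) (l : Fin m) : ℂ :=
  fderiv ℂ (fun w' => F w' i) w (Pi.single l 1)

/-- A Hermitian metric on an open set `U` of the coordinate space `ι → ℂ`, given by its matrix of
coefficients `g_{i j̄}`: Hermitian, positive definite and smooth on `U`. -/
structure HermMetricOn {ι : Type*} [Fintype ι] [DecidableEq ι] (U : Set (ι → ℂ)) where
  g : (ι → ℂ) → Matrix ι ι ℂ
  isHermitian : ∀ z ∈ U, (g z).IsHermitian
  posDef : ∀ z ∈ U, (g z).PosDef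
  smooth : ∀ i j, ContDiffOn ℝ (⊤ : ℕ∞) (fun z => g z i j) U

/-- The matrix of coefficients of the pullback `F^*ω_N` of the Hermitian form with matrix `gN`
under a holomorphic map `F`:  `(F^*ω_N)_{l k̄} = Σ_{i,j} (g_N)_{i j̄}(F w) ∂F_i/∂w_l conj(∂F_j/∂w_k)`. -/
def pullbackMetric {m : ℕ} {ι : Type*} [Fintype ι]
    (gN : (ι → ℂ) → Matrix ι ι ℂ) (F : (Fin m → ℂ) → ι → ℂ) (w : Fin m → ℂ) :
    Matrix (Fin m) (Fin m) ℂ :=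
  Matrix.of fun l k => ∑ i, ∑ j, gN (F w) i j * Jac F w i l * (starRingEnd ℂ) (Jac F w j k)

/-- `F^*ω_N^p = λ ω_M^p` on `V`, expressed in coordinates: all corresponding `p×p` minors
(the coefficients of the two (p,p)-forms on increasing multi-indices) agree up to the factor λ. -/
def PreservesPP {m : ℕ} {ι : Type*} [Fintype ι]
    (gM : (Fin m → ℂ) → Matrix (Fin m) (Fin m) ℂ) (gN : (ι → ℂ) → Matrix ι ι ℂ)
    (F : (Fin m → ℂ) → ι → ℂ) (V : Set (Fin m → ℂ)) (p : ℕ) (lam : ℝ) : Prop :=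
  ∀ w ∈ V, ∀ L K : Fin p → Fin m, StrictMono L → StrictMono K →
    ((pullbackMetric gN F w).submatrix L K).det = (lam : ℂ) * ((gM w).submatrix L K).det

/-- Wirtinger derivative ∂/∂z_k of a function of several complex variables. -/
def wdz {ι : Type*} [Fintype ι] [DecidableEq ι] (k : ι) (f : (ι → ℂ) → ℂ) (z : ι → ℂ) : ℂ :=
  (fderiv ℝ f z (Pi.single k 1) - Complex.I * fderiv ℝ f z (Pi.single k Complex.I)) / 2

/-- Conjugate Wirtinger derivative ∂/∂z̄_k. -/
def wdzbar {ι : Type*} [Fintype ι] [DecidableEq ι] (k : ι) (f : (ι → ℂ) → ℂ) (z : ι → ℂ) : ℂ :=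
  (fderiv ℝ f z (Pi.single k 1) + Complex.I * fderiv ℝ f z (Pi.single k Complex.I)) / 2

/-- A bounded symmetric domain in `ℂ^m`: a bounded connected open set such that every point is
an isolated fixed point of a holomorphic involution of the domain. -/
structure IsBddSymmDomain {m : ℕ} (D : Set (Fin m → ℂ)) : Prop where
  isOpen : IsOpen D
  isConnected : IsConnected D
  isBounded : Bornology.IsBounded D
  symm : ∀ x ∈ D, ∃ σ : (Fin m → ℂ) → (Fin m → ℂ),
    DifferentiableOn ℂ σ D ∧ Set.MapsTo σ D D ∧ (∀ z ∈ D, σ (σ z) = z) ∧ σ x = x ∧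
    ∃ ε > 0, ∀ y ∈ D, dist y x < ε → σ y = y → y = x

/-- A canonical Kähler metric on a bounded symmetric domain `D`: a Kähler metric invariant under
all automorphisms of `D`.  (For a bounded symmetric domain with irreducible factors `D_j` these
are exactly the metrics `Σ_j λ_j Pr_j^* g_{D_j}`, `λ_j > 0`.) -/
def IsCanonicalKahlerMetric {m : ℕ} (D : Set (Fin m → ℂ)) (G : HermMetricOn D) : Prop :=
  (∀ i j k, ∀ z ∈ D, wdz k (fun w => G.g w i j) z = wdz i (fun w => G.g w k j) z) ∧
  ∀ ψ : (Fin m → ℂ) → (Fin m → ℂ),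
    DifferentiableOn ℂ ψ D → Set.MapsTo ψ D D →
    (∃ ψinv : (Fin m → ℂ) → (Fin m → ℂ), DifferentiableOn ℂ ψinv D ∧ Set.MapsTo ψinv D D ∧
      (∀ z ∈ D, ψinv (ψ z) = z) ∧ (∀ z ∈ D, ψ (ψinv z) = z)) →
    ∀ z ∈ D, pullbackMetric G.g ψ z = G.g z

/-- The Fubini–Study metric of constant holomorphic sectional curvature 2 on ℙ^N, in the
inhomogeneous coordinates of an affine chart:
`g_{i j̄}(z) = ((1+‖z‖²)δ_{ij} − z̄_i z_j)/(1+‖z‖²)²`. -/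
def fubiniStudy (N : ℕ) (z : Fin N → ℂ) : Matrix (Fin N) (Fin N) ℂ :=
  Matrix.of fun i j =>
    ((1 + ((∑ a, Complex.normSq (z a) : ℝ) : ℂ)) * (if i = j then 1 else 0)
        - (starRingEnd ℂ) (z i) * z j)
      / (1 + ((∑ a, Complex.normSq (z a) : ℝ) : ℂ)) ^ 2

/-- The product metric `μ₁ g_{FS} × ⋯ × μ_l g_{FS}` on the product of the affine charts of
`ℙ^{N₁} × ⋯ × ℙ^{N_l}`, with coordinates indexed by `Σ j, Fin (N j)`. -/
def prodFS {l : ℕ} (N : Fin l → ℕ) (μ : Fin l → ℝ) (z : (Σ j, Fin (N j)) → ℂ) :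
    Matrix (Σ j, Fin (N j)) (Σ j, Fin (N j)) ℂ :=
  Matrix.of fun x y =>
    if h : x.1 = y.1 then
      (μ x.1 : ℂ) * fubiniStudy (N x.1) (fun a => z ⟨x.1, a⟩) x.2
        (Fin.cast (congrArg N h.symm) y.2)
    else 0

section ComplexAnalysis

open Metric

variable {E F : Type*} [NormedAddCommGroup E] [NormedSpace ℂ E]
  [NormedAddCommGroup F] [NormedSpace ℂ F]

theorem norm_fderiv_le_of_norm_le_on_ball {f : E → F} {c : E} {R C : ℝ} (hR : 0 < R)
    (hd : DifferentiableOn ℂ f (ball c R)) (hC : ∀ z ∈ ball c R, ‖f z‖ ≤ C) :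
    ‖fderiv ℂ f c‖ ≤ 2 * C / R := by
  refine Complex.norm_fderiv_le_div_of_mapsTo_ball hd (fun z hz => ?_) hR
  rw [mem_closedBall, dist_eq_norm]
  have h1 := hC z hz
  have h2 := hC c (mem_ball_self hR)
  linarith [norm_sub_le (f z) (f c)]

/-- Second order Taylor estimate for bounded holomorphic maps. -/
theorem norm_sub_sub_fderiv_le_of_norm_le_on_ball {f : E → F} {c z : E} {R C : ℝ}
    (hd : DifferentiableOn ℂ f (ball c R)) (hC : ∀ z ∈ ball c R, ‖f z‖ ≤ C)
    (hz : z ∈ ball c R) :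
    ‖f z - f c - fderiv ℂ f c (z - c)‖ ≤ 4 * C * (‖z - c‖ / R) ^ 2 := by
  have hR : 0 < R := nonempty_ball.mp ⟨_, hz⟩
  have hdc : DifferentiableAt ℂ f c := hd.differentiableAt (ball_mem_nhds c hR)
  have key := Complex.dist_le_mul_div_pow_of_mapsTo_ball_of_isLittleO
    (f := fun y => f y - fderiv ℂ f c (y - c)) (c := c) (z := z) (R₁ := R) (R₂ := 4 * C) (n := 1)
    ?_ ?_ ?_ hz
  · simpa [dist_eq_norm, sub_right_comm] using key
  · exact hd.sub ((fderiv ℂ f c).differentiable.comp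
      (differentiable_id.sub_const c)).differentiableOn
  · intro y hy
    rw [mem_closedBall, dist_eq_norm]
    have h1 := hC y hy
    have h2 := hC c (mem_ball_self hR)
    have h3 : ‖fderiv ℂ f c (y - c)‖ ≤ 2 * C := by
      refine ((fderiv ℂ f c).le_opNorm _).trans ?_
      have hy' : ‖y - c‖ ≤ R := by rw [← dist_eq_norm]; exact (mem_ball.mp hy).le
      calc ‖fderiv ℂ f c‖ * ‖y - c‖ ≤ (2 * C / R) * R := by
            gcongr
            · exact div_nonneg (by linarith [norm_nonneg (f c)]) hR.le
            · exact norm_fderiv_le_of_norm_le_on_ball hR hd hC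
        _ = 2 * C := by field_simp
    simp only [sub_self, map_zero, sub_zero]
    calc ‖f y - fderiv ℂ f c (y - c) - f c‖ ≤ ‖f y - fderiv ℂ f c (y - c)‖ + ‖f c‖ :=
          norm_sub_le _ _
      _ ≤ ‖f y‖ + ‖fderiv ℂ f c (y - c)‖ + ‖f c‖ := by gcongr; exact norm_sub_le _ _
      _ ≤ 4 * C := by linarith
  · have h := hdc.hasFDerivAt.isLittleO
    simp only [pow_one, sub_self, map_zero, sub_zero]
    refine (h.norm_right).congr_left fun y => ?_
    abel

/-- Directional derivatives of a holomorphic function of several variables are holomorphic. -/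
theorem differentiableOn_fderiv_apply [FiniteDimensional ℂ E]
    {f : E → ℂ} {W : Set E} (hW : IsOpen W) (hf : DifferentiableOn ℂ f W) (v : E) :
    DifferentiableOn ℂ (fun z => fderiv ℂ f z v) W := by
  borelize E
  intro x hx
  refine DifferentiableAt.differentiableWithinAt ?_
  have hfx : DifferentiableAt ℂ f x := hf.differentiableAt (hW.mem_nhds hx)
  obtain ⟨δ, hδ, hball⟩ : ∃ δ > 0, ball x (3 * δ) ⊆ W ∩ {y | ‖f y‖ < ‖f x‖ + 1} := by
    have : W ∩ {y | ‖f y‖ < ‖f x‖ + 1} ∈ nhds x := by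
      refine Filter.inter_mem (hW.mem_nhds hx) ?_
      exact (hfx.continuousAt.norm).eventually_lt continuousAt_const (by simp)
    obtain ⟨ε, hε, h⟩ := Metric.mem_nhds_iff.mp this
    exact ⟨ε / 3, by positivity, by convert h using 2; ring⟩
  set C := ‖f x‖ + 1
  obtain ⟨r, hr, hrv⟩ : ∃ r > 0, r * ‖v‖ < δ := by
    refine ⟨δ / (‖v‖ + 1), by positivity, ?_⟩
    rw [div_mul_eq_mul_div, div_lt_iff₀ (by positivity)]
    nlinarith [norm_nonneg v]
  have hmem : ∀ z ∈ ball x δ, ∀ t ∈ closedBall (0 : ℂ) r, z + t • v ∈ ball x (2 * δ) := by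
    intro z hz t ht
    rw [mem_ball, dist_eq_norm] at hz ⊢
    rw [mem_closedBall, dist_zero_right] at ht
    calc ‖z + t • v - x‖ = ‖(z - x) + t • v‖ := by congr 1; abel
      _ ≤ ‖z - x‖ + ‖t‖ * ‖v‖ := (norm_add_le _ _).trans (by rw [norm_smul])
      _ ≤ ‖z - x‖ + r * ‖v‖ := by gcongr
      _ < 2 * δ := by linarith
  have h23 : ball x (2 * δ) ⊆ ball x (3 * δ) := ball_subset_ball (by linarith)
  have hfd : ∀ y ∈ ball x (2 * δ), DifferentiableAt ℂ f y := fun y hy =>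
    hf.differentiableAt (hW.mem_nhds (hball (h23 hy)).1)
  have hbd : ∀ y ∈ ball x (2 * δ), ‖fderiv ℂ f y‖ ≤ 2 * C / δ := by
    intro y hy
    have hsub : ball y δ ⊆ ball x (3 * δ) := ball_subset_ball' (by
      rw [mem_ball] at hy; linarith)
    exact norm_fderiv_le_of_norm_le_on_ball hδ (hf.mono fun w hw => (hball (hsub hw)).1)
      fun w hw => (hball (hsub hw)).2.le
  have hcm : ∀ θ : ℝ, circleMap 0 r θ ∈ closedBall (0 : ℂ) r := fun θ =>
    circleMap_mem_closedBall _ hr.le _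
  have hrep : ∀ z ∈ ball x δ, fderiv ℂ f z v =
      (2 * (Real.pi : ℂ) * I)⁻¹ * ∫ θ in (0 : ℝ)..2 * Real.pi,
        (deriv (circleMap 0 r) θ * ((circleMap 0 r θ) ^ 2)⁻¹) * f (z + circleMap 0 r θ • v) := by
    intro z hz
    have hU : IsOpen ((fun t : ℂ => z + t • v) ⁻¹' ball x (2 * δ)) :=
      isOpen_ball.preimage (by fun_prop)
    have hline : DifferentiableOn ℂ (fun t : ℂ => f (z + t • v))
        ((fun t : ℂ => z + t • v) ⁻¹' ball x (2 * δ)) := by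
      intro t ht
      exact ((hfd _ ht).comp t (f := fun t : ℂ => z + t • v)
        (by fun_prop)).differentiableWithinAt
    have h := Complex.two_pi_I_inv_smul_circleIntegral_sub_sq_inv_smul_of_differentiable hU
      (c := 0) (w₀ := 0) (R := r) (fun t ht => hmem z hz t ht) hline (mem_ball_self hr)
    have hderiv : deriv (fun t : ℂ => f (z + t • v)) 0 = fderiv ℂ f z v := by
      have h1 : HasDerivAt (fun t : ℂ => z + t • v) v 0 := by
        simpa using ((hasDerivAt_id (0 : ℂ)).smul_const v).const_add z
      have h2 : HasFDerivAt f (fderiv ℂ f z) (z + (0 : ℂ) • v) := by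
        simpa using (hfd z (by simpa using hmem z hz 0 (by simp [hr.le]))).hasFDerivAt
      exact (h2.comp_hasDerivAt 0 h1).deriv
    rw [← hderiv, ← h, circleIntegral]
    simp [mul_assoc]
  have hF := intervalIntegral.hasFDerivAt_integral_of_dominated_of_fderiv_le
    (𝕜 := ℂ) (μ := MeasureTheory.volume) (a := 0) (b := 2 * Real.pi) (x₀ := x) (s := ball x δ)
    (bound := fun _ => r⁻¹ * (2 * C / δ))
    (F := fun z θ => (deriv (circleMap 0 r) θ * ((circleMap 0 r θ) ^ 2)⁻¹) *
      f (z + circleMap 0 r θ • v))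
    (F' := fun z θ => (deriv (circleMap 0 r) θ * ((circleMap 0 r θ) ^ 2)⁻¹) •
      fderiv ℂ f (z + circleMap 0 r θ • v)) (ball_mem_nhds x hδ) ?_ ?_ ?_ ?_ ?_ ?_
  · refine (hF.differentiableAt.const_mul ((2 * (Real.pi : ℂ) * I)⁻¹)).congr_of_eventuallyEq ?_
    filter_upwards [ball_mem_nhds x hδ] with z hz using hrep z hz
  all_goals
    have hker : Continuous fun θ : ℝ =>
        (deriv (circleMap 0 r) θ * ((circleMap 0 r θ) ^ 2)⁻¹) := by
      simp only [deriv_circleMap]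
      refine ((continuous_circleMap 0 r).mul continuous_const).mul (Continuous.inv₀ (by fun_prop) ?_)
      intro θ
      exact pow_ne_zero 2 (circleMap_ne_center hr.ne')
    have hcont : ∀ z ∈ ball x δ, Continuous fun θ : ℝ =>
        (deriv (circleMap 0 r) θ * ((circleMap 0 r θ) ^ 2)⁻¹) * f (z + circleMap 0 r θ • v) := by
      intro z hz
      refine hker.mul (continuous_iff_continuousAt.mpr fun θ => ?_)
      exact ContinuousAt.comp (f := fun θ => z + circleMap 0 r θ • v)
        (hfd _ (hmem z hz _ (hcm θ))).continuousAt (by fun_prop)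
  · filter_upwards [ball_mem_nhds x hδ] with z hz
    exact (hcont z hz).aestronglyMeasurable
  · exact (hcont x (mem_ball_self hδ)).intervalIntegrable _ _
  · refine hker.aestronglyMeasurable.smul ?_
    have : Measurable fun θ : ℝ => fderiv ℂ f (x + circleMap 0 r θ • v) :=
      (measurable_fderiv ℂ f).comp (by fun_prop)
    exact this.aestronglyMeasurable
  · refine Filter.Eventually.of_forall fun θ _ z hz => ?_
    rw [norm_smul]
    have : ‖deriv (circleMap 0 r) θ * ((circleMap 0 r θ) ^ 2)⁻¹‖ = r⁻¹ := by
      simp [deriv_circleMap, abs_of_pos hr]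
      field_simp
    rw [this]
    gcongr
    exact hbd _ (hmem z hz _ (hcm θ))
  · exact intervalIntegrable_const
  · refine Filter.Eventually.of_forall fun θ _ z hz => ?_
    have h1 : HasFDerivAt (fun z => f (z + circleMap 0 r θ • v))
        (fderiv ℂ f (z + circleMap 0 r θ • v)) z := by
      have := (hfd _ (hmem z hz _ (hcm θ))).hasFDerivAt
      exact (hasFDerivAt_comp_add_right (circleMap 0 r θ • v)).mpr this
    simpa using h1.const_mul _

end ComplexAnalysis

section CompoundMatrices

open Matrix

theorem Matrix.det_mul_eq_sum_prod_mul_det_submatrix {R ι κ : Type*} [CommRing R] [Fintype ι]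
    [DecidableEq ι] [Fintype κ] (X : Matrix ι κ R) (M : Matrix κ ι R) :
    (X * M).det = ∑ r : ι → κ, (∏ i, X i (r i)) * (M.submatrix r id).det := by
  have h : X * M = fun i => ∑ j, X i j • M j := by
    ext i l
    simp [Matrix.mul_apply, Finset.sum_apply]
  change (detRowAlternating : (ι → R) [⋀^ι]→ₗ[R] R).toMultilinearMap (X * M) = _
  rw [h, MultilinearMap.map_sum]
  refine Finset.sum_congr rfl fun r _ => ?_
  rw [MultilinearMap.map_smul_univ]
  rfl

variable {m p : ℕ} {R : Type*} [CommRing R]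

theorem exists_perm_strictMono_comp {L : Fin p → Fin m} (hL : Function.Injective L) :
    ∃ σ : Equiv.Perm (Fin p), StrictMono (L ∘ σ) :=
  ⟨Tuple.sort L, (Tuple.monotone_sort L).strictMono_of_injective
    (hL.comp (Tuple.sort L).injective)⟩

/-- If all minors with increasing indices are proportional, so are all minors. -/
theorem det_submatrix_eq_of_strictMono {A B : Matrix (Fin m) (Fin m) R} {c : R}
    (h : ∀ L K : Fin p → Fin m, StrictMono L → StrictMono K →
      (A.submatrix L K).det = c * (B.submatrix L K).det) (L K : Fin p → Fin m) :
    (A.submatrix L K).det = c * (B.submatrix L K).det := by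
  by_cases hL : Function.Injective L
  swap
  · obtain ⟨i, j, hij, hne⟩ : ∃ i j, L i = L j ∧ i ≠ j := by
      simpa [Function.Injective] using hL
    rw [det_zero_of_row_eq hne, det_zero_of_row_eq hne, mul_zero] <;>
    · ext k; simp [hij]
  by_cases hK : Function.Injective K
  swap
  · obtain ⟨i, j, hij, hne⟩ : ∃ i j, K i = K j ∧ i ≠ j := by
      simpa [Function.Injective] using hK
    rw [det_zero_of_column_eq hne, det_zero_of_column_eq hne, mul_zero] <;>
    · intro k; simp [hij]
  obtain ⟨σ, hσ⟩ := exists_perm_strictMono_comp hL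
  obtain ⟨τ, hτ⟩ := exists_perm_strictMono_comp hK
  have key : ∀ M : Matrix (Fin m) (Fin m) R, (M.submatrix (L ∘ σ) (K ∘ τ)).det =
      (Equiv.Perm.sign σ : ℤ) * ((Equiv.Perm.sign τ : ℤ) * (M.submatrix L K).det) := by
    intro M
    have h1 := det_permute σ (M.submatrix L (K ∘ τ))
    have h2 := det_permute' τ (M.submatrix L K)
    rw [submatrix_submatrix] at h1 h2
    rw [← h2]
    exact h1
  have hs : ∀ π : Equiv.Perm (Fin p),
      ((Equiv.Perm.sign π : ℤ) : R) * ((Equiv.Perm.sign π : ℤ) : R) = 1 := by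
    intro π
    rw [← Int.cast_mul, ← Units.val_mul, Int.units_mul_self]; simp
  have h0 := h _ _ hσ hτ
  rw [key, key] at h0
  linear_combination ((Equiv.Perm.sign σ : ℤ) : R) * ((Equiv.Perm.sign τ : ℤ) : R) * h0 -
    ((A.submatrix L K).det - c * (B.submatrix L K).det) *
      (hs σ * ((Equiv.Perm.sign τ : ℤ) : R) * ((Equiv.Perm.sign τ : ℤ) : R) + hs τ)

theorem det_mul_mul_eq_of_det_submatrix_eq {A B : Matrix (Fin m) (Fin m) R} {c : R}
    (h : ∀ L K : Fin p → Fin m, (A.submatrix L K).det = c * (B.submatrix L K).det)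
    (X : Matrix (Fin p) (Fin m) R) (Y : Matrix (Fin m) (Fin p) R) :
    (X * A * Y).det = c * (X * B * Y).det := by
  have key : ∀ M : Matrix (Fin m) (Fin m) R, (X * M * Y).det =
      ∑ r : Fin p → Fin m, (∏ i, X i (r i)) *
        ∑ s : Fin p → Fin m, (∏ i, Y (s i) i) * (M.submatrix r s).det := by
    intro M
    rw [Matrix.mul_assoc, det_mul_eq_sum_prod_mul_det_submatrix]
    refine Finset.sum_congr rfl fun r _ => ?_
    congr 1
    have : (M * Y).submatrix r id = M.submatrix r id * Y := by
      ext i j; simp [Matrix.mul_apply]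
    rw [this, ← det_transpose, transpose_mul, det_mul_eq_sum_prod_mul_det_submatrix]
    refine Finset.sum_congr rfl fun s _ => ?_
    congr 1
    rw [← det_transpose]
    rfl
  rw [key, key, Finset.mul_sum]
  refine Finset.sum_congr rfl fun r _ => ?_
  rw [mul_left_comm]
  congr 1
  rw [Finset.mul_sum]
  refine Finset.sum_congr rfl fun s _ => ?_
  rw [h]; ring

/-- Simultaneous diagonalization of a Hermitian and a positive definite matrix. -/
theorem exists_simultaneous_diagonalization {n : Type*} [Fintype n] [DecidableEq n]
    {A B : Matrix n n ℂ} (hA : A.PosSemidef) (hB : B.PosDef) :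
    ∃ (T : Matrix n n ℂ) (a : n → ℝ), (∀ i, 0 ≤ a i) ∧ Tᴴ * B * T = 1 ∧
      Tᴴ * A * T = Matrix.diagonal fun i => (a i : ℂ) := by
  have hspec : ∀ {M : Matrix n n ℂ} (hM : M.IsHermitian),
      (hM.eigenvectorUnitary : Matrix n n ℂ)ᴴ * M * (hM.eigenvectorUnitary : Matrix n n ℂ) =
        Matrix.diagonal fun i => (hM.eigenvalues i : ℂ) := by
    intro M hM
    have h1 := hM.spectral_theorem
    set U := hM.eigenvectorUnitary
    have hU : (U : Matrix n n ℂ)ᴴ * (U : Matrix n n ℂ) = 1 := by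
      have := Unitary.coe_star_mul_self U
      rwa [star_eq_conjTranspose] at this
    rw [Unitary.conjStarAlgAut_apply, star_eq_conjTranspose] at h1
    calc (U : Matrix n n ℂ)ᴴ * M * (U : Matrix n n ℂ)
        = ((U : Matrix n n ℂ)ᴴ * (U : Matrix n n ℂ)) *
          Matrix.diagonal (RCLike.ofReal ∘ hM.eigenvalues) *
          ((U : Matrix n n ℂ)ᴴ * (U : Matrix n n ℂ)) := by
            conv_lhs => rw [h1]
            simp only [Matrix.mul_assoc]
      _ = _ := by rw [hU, Matrix.one_mul, Matrix.mul_one]; rfl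
  set U : Matrix n n ℂ := (hB.1.eigenvectorUnitary : Matrix n n ℂ)
  set b := hB.1.eigenvalues
  have hb : ∀ i, 0 < b i := hB.eigenvalues_pos
  set D : Matrix n n ℂ := Matrix.diagonal fun i => ((Real.sqrt (b i))⁻¹ : ℝ)
  have hD : Dᴴ = D := by
    simp only [D, diagonal_conjTranspose]
    congr 1
    ext i
    exact Complex.conj_ofReal _
  have hR : (U * D)ᴴ * B * (U * D) = 1 := by
    have h1 := hspec hB.1
    calc (U * D)ᴴ * B * (U * D) = D * (Uᴴ * B * U) * D := by
          rw [conjTranspose_mul, hD]; simp only [Matrix.mul_assoc]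
      _ = 1 := by
          rw [h1, diagonal_mul_diagonal, diagonal_mul_diagonal, ← diagonal_one]
          congr 1
          ext i
          rw [← Complex.ofReal_mul, ← Complex.ofReal_mul, ← Complex.ofReal_one]
          congr 1
          have h2 := Real.mul_self_sqrt (hb i).le
          have h3 : Real.sqrt (b i) ≠ 0 := (Real.sqrt_pos.mpr (hb i)).ne'
          field_simp
          exact h2.symm.trans (sq _).symm
  have hA' : ((U * D)ᴴ * A * (U * D)).PosSemidef := hA.conjTranspose_mul_mul_same _
  set V : Matrix n n ℂ := (hA'.1.eigenvectorUnitary : Matrix n n ℂ)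
  have hVV : Vᴴ * V = 1 := by
    have := Unitary.coe_star_mul_self hA'.1.eigenvectorUnitary
    rwa [star_eq_conjTranspose] at this
  refine ⟨U * D * V, hA'.1.eigenvalues, hA'.eigenvalues_nonneg, ?_, ?_⟩
  · calc (U * D * V)ᴴ * B * (U * D * V) = Vᴴ * ((U * D)ᴴ * B * (U * D)) * V := by
          rw [conjTranspose_mul (U * D)]; simp only [Matrix.mul_assoc]
      _ = 1 := by rw [hR, Matrix.mul_one, hVV]
  · calc (U * D * V)ᴴ * A * (U * D * V) = Vᴴ * ((U * D)ᴴ * A * (U * D)) * V := by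
          rw [conjTranspose_mul (U * D)]; simp only [Matrix.mul_assoc]
      _ = _ := hspec hA'.1

/-- If the `p × p` minors of a positive semidefinite matrix are proportional to those of a
positive definite one, then so are the determinants, with a universal factor. -/
theorem exists_det_eq_mul_det_of_minors (hp : 1 ≤ p) (hpm : p ≤ m) {lam : ℝ} (hlam : 0 < lam) :
    ∃ c : ℝ, 0 < c ∧ ∀ A B : Matrix (Fin m) (Fin m) ℂ, A.PosSemidef → B.PosDef →
      (∀ L K : Fin p → Fin m, StrictMono L → StrictMono K →
        (A.submatrix L K).det = (lam : ℂ) * (B.submatrix L K).det) →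
      A.det = (c : ℂ) * B.det := by
  rcases hpm.eq_or_lt with rfl | hlt
  · refine ⟨lam, hlam, fun A B _ _ h => ?_⟩
    simpa using h id id strictMono_id strictMono_id
  refine ⟨(lam ^ ((p : ℝ)⁻¹)) ^ m, by positivity, fun A B hA hB h => ?_⟩
  obtain ⟨T, a, ha, hTB, hTA⟩ := exists_simultaneous_diagonalization hA hB
  have hprod : ∀ L : Fin p → Fin m, Function.Injective L → ∏ i, a (L i) = lam := by
    intro L hL
    have h1 := det_mul_mul_eq_of_det_submatrix_eq (det_submatrix_eq_of_strictMono h)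
      (Tᴴ.submatrix L id) (T.submatrix id L)
    have h2 : ∀ M : Matrix (Fin m) (Fin m) ℂ,
        Tᴴ.submatrix L id * M * T.submatrix id L = (Tᴴ * M * T).submatrix L L := by
      intro M; ext i j; simp [Matrix.mul_apply]
    rw [h2, h2, hTA, hTB, submatrix_one L hL, det_one, mul_one,
      submatrix_diagonal _ L hL, det_diagonal] at h1
    simp only [Function.comp] at h1
    exact_mod_cast h1
  have hconst : ∀ i j, a i = a j := by
    intro i j
    by_cases hij : i = j
    · rw [hij]
    obtain ⟨S, hiS, hS⟩ : ∃ S : Finset (Fin m), S ⊆ ({i, j} : Finset (Fin m))ᶜ ∧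
        S.card = p - 1 := by
      refine Finset.exists_subset_card_eq ?_
      rw [Finset.card_compl, Finset.card_pair hij, Fintype.card_fin]; omega
    have hval : ∀ k ∈ ({i, j} : Finset (Fin m)), a k * ∏ x ∈ S, a x = lam := by
      intro k hk
      have hkS : k ∉ S := fun hkS => (Finset.mem_compl.mp (hiS hkS)) hk
      have hcard : (insert k S).card = p := by
        rw [Finset.card_insert_of_notMem hkS, hS]; omega
      rw [← Finset.prod_insert hkS, ← hprod _ ((insert k S).orderEmbOfFin hcard).injective,
        ← Finset.prod_image (g := (insert k S).orderEmbOfFin hcard) (s := Finset.univ)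
          (fun x _ y _ hxy => ((insert k S).orderEmbOfFin hcard).injective hxy)]
      congr 1
      exact (Finset.image_orderEmbOfFin_univ _ hcard).symm
    have hi := hval i (by simp)
    have hj := hval j (by simp)
    have hne : ∏ x ∈ S, a x ≠ 0 := by
      intro h0
      rw [h0, mul_zero] at hi
      exact hlam.ne hi
    exact mul_right_cancel₀ hne (hi.trans hj.symm)
  have hval : ∀ i, a i = lam ^ ((p : ℝ)⁻¹) := by
    intro i
    have h1 := hprod (Fin.castLE hlt.le) (Fin.castLE_injective _)
    rw [Finset.prod_congr rfl fun j _ => hconst _ i, Finset.prod_const, Finset.card_univ,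
      Fintype.card_fin] at h1
    rw [← h1, Real.pow_rpow_inv_natCast (ha i) (by omega)]
  have hdetA := congrArg det hTA
  have hdetB := congrArg det hTB
  rw [det_mul, det_mul, det_diagonal] at hdetA
  rw [det_mul, det_mul, det_one] at hdetB
  simp only [hval, Finset.prod_const, Finset.card_univ, Fintype.card_fin] at hdetA
  have hT : Tᴴ.det * T.det ≠ 0 := by
    intro h0
    have : Tᴴ.det * B.det * T.det = 0 := by linear_combination B.det * h0
    exact zero_ne_one (this.symm.trans hdetB)
  refine mul_left_cancel₀ hT ?_
  push_cast
  linear_combination hdetA - ((lam ^ ((p : ℝ)⁻¹) : ℝ) : ℂ) ^ m * hdetB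

end CompoundMatrices

section SesquiholomorphicKernels

open Metric ComplexConjugate

variable {E : Type*} [NormedAddCommGroup E] [NormedSpace ℂ E]

/-- A kernel `k z w` is sesquiholomorphic on `W` if it is holomorphic along all the curves
`t ↦ (a + t b, a + t̄ b)`. -/
def IsSesquiholomorphicOn (k : E → E → ℂ) (W : Set E) : Prop :=
  ∀ (a b : E) (t : ℂ), a + t • b ∈ W → a + conj t • b ∈ W →
    DifferentiableAt ℂ (fun t : ℂ => k (a + t • b) (a + conj t • b)) t

theorem IsSesquiholomorphicOn.sub {k k' : E → E → ℂ} {W : Set E}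
    (h : IsSesquiholomorphicOn k W) (h' : IsSesquiholomorphicOn k' W) :
    IsSesquiholomorphicOn (fun z w => k z w - k' z w) W :=
  fun a b t h1 h2 => (h a b t h1 h2).sub (h' a b t h1 h2)

theorem IsSesquiholomorphicOn.mul {k k' : E → E → ℂ} {W : Set E}
    (h : IsSesquiholomorphicOn k W) (h' : IsSesquiholomorphicOn k' W) :
    IsSesquiholomorphicOn (fun z w => k z w * k' z w) W :=
  fun a b t h1 h2 => (h a b t h1 h2).mul (h' a b t h1 h2)

theorem eq_zero_at_I_of_eq_zero_on_real {g : ℂ → ℂ} (hg : DifferentiableOn ℂ g (ball 0 2))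
    (h0 : ∀ t : ℝ, |t| < 2 → g t = 0) : g I = 0 := by
  have han : AnalyticOnNhd ℂ g (ball 0 2) := hg.analyticOnNhd isOpen_ball
  have hfreq : ∃ᶠ z in nhdsWithin (0 : ℂ) {0}ᶜ, g z = 0 := by
    rw [Filter.frequently_iff]
    intro U hU
    obtain ⟨ε, hε, hU⟩ := Metric.mem_nhdsWithin_iff.mp hU
    have hmin : 0 < min (ε / 2) 1 := by positivity
    refine ⟨((min (ε / 2) 1 : ℝ) : ℂ), hU ⟨?_, ?_⟩, h0 _ ?_⟩
    · rw [mem_ball, dist_zero_right, Complex.norm_real, Real.norm_eq_abs, abs_of_pos hmin]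
      linarith [min_le_left (ε / 2) 1]
    · simpa using hmin.ne'
    · rw [abs_of_pos hmin]
      linarith [min_le_right (ε / 2) 1]
  have := han.eqOn_zero_of_preconnected_of_frequently_eq_zero
    (convex_ball (0 : ℂ) 2).isPreconnected (mem_ball_self (by norm_num)) hfreq
  exact this (by simp)

/-- Polarization: a sesquiholomorphic kernel vanishing on the diagonal vanishes. -/
theorem IsSesquiholomorphicOn.eq_zero_of_diagonal {k : E → E → ℂ} {c : E} {r : ℝ}
    (hk : IsSesquiholomorphicOn k (ball c (3 * r))) (h0 : ∀ z ∈ ball c (3 * r), k z z = 0)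
    {z w : E} (hz : z ∈ ball c r) (hw : w ∈ ball c r) : k z w = 0 := by
  set a : E := (2 : ℂ)⁻¹ • (z + w) with ha
  set b : E := (2 * I)⁻¹ • (z - w) with hb
  have hmem : ∀ t ∈ ball (0 : ℂ) 2, a + t • b ∈ ball c (3 * r) := by
    intro t ht
    rw [mem_ball, dist_eq_norm] at *
    rw [sub_zero] at ht
    have h1 : a + t • b - c = (2 : ℂ)⁻¹ • ((z - c) + (w - c)) +
        (t * (2 * I)⁻¹) • ((z - c) - (w - c)) := by
      rw [ha, hb]; module
    have h2 : ‖(2 : ℂ)⁻¹ • ((z - c) + (w - c))‖ < r := by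
      rw [norm_smul]
      have := norm_add_le (z - c) (w - c)
      norm_num
      linarith
    have h3 : ‖(t * (2 * I)⁻¹) • ((z - c) - (w - c))‖ ≤ 2 * r := by
      rw [norm_smul]
      have := norm_sub_le (z - c) (w - c)
      have h4 : ‖t * (2 * I)⁻¹‖ ≤ 1 := by simp; linarith
      calc _ ≤ 1 * ‖(z - c) - (w - c)‖ := by gcongr
        _ ≤ 2 * r := by linarith
    rw [h1]
    linarith [norm_add_le ((2 : ℂ)⁻¹ • ((z - c) + (w - c)))
      ((t * (2 * I)⁻¹) • ((z - c) - (w - c)))]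
  have h := eq_zero_at_I_of_eq_zero_on_real
    (g := fun t : ℂ => k (a + t • b) (a + conj t • b)) ?_ ?_
  · have e1 : a + I • b = z := by
      have : I * (2 * I)⁻¹ = 2⁻¹ := by field_simp
      rw [ha, hb, smul_smul, this]; module
    have e2 : a + conj I • b = w := by
      have : conj I * (2 * I)⁻¹ = -2⁻¹ := by rw [conj_I]; field_simp
      rw [ha, hb, smul_smul, this]; module
    simpa only [e1, e2] using h
  · intro t ht
    exact (hk a b t (hmem t ht) (hmem _ (by simpa using ht))).differentiableWithinAt
  · intro t ht
    simp only [conj_ofReal]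
    exact h0 _ (hmem _ (by simpa using ht))

/-- If `φ` is holomorphic then so is `t ↦ L (φ t̄)` for every antilinear `L`. -/
theorem differentiableAt_antilinear_comp_conj {F G : Type*} [NormedAddCommGroup F]
    [NormedSpace ℂ F] [NormedAddCommGroup G] [NormedSpace ℂ G] (L : F →SL[starRingEnd ℂ] G)
    {φ : ℂ → F} {t : ℂ} (hφ : DifferentiableAt ℂ φ (conj t)) :
    DifferentiableAt ℂ (fun s => L (φ (conj s))) t := by
  have h1 : HasFDerivAt φ ((fderiv ℂ φ (conj t)).restrictScalars ℝ) (conj t) :=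
    hφ.hasFDerivAt.restrictScalars ℝ
  let L' : F →L[ℝ] G :=
    { toFun := L
      map_add' := L.map_add
      map_smul' := fun c x => by
        have := L.map_smulₛₗ (c : ℂ) x
        simpa using this
      cont := L.continuous }
  have h2 : HasFDerivAt (fun s => L' (φ (conjCLE s)))
      ((L'.comp ((fderiv ℂ φ (conj t)).restrictScalars ℝ)).comp conjCLE.toContinuousLinearMap) t :=
    (L'.hasFDerivAt.comp (conj t) h1).comp t (f := fun s => conjCLE s) conjCLE.hasFDerivAt
  have h3 := hasFDerivAt_of_restrictScalars ℝ (𝕜' := ℂ)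
    (f' := ContinuousLinearMap.toSpanSingleton ℂ (L (fderiv ℂ φ (conj t) 1))) h2 ?_
  · exact h3.differentiableAt
  · ext
    simp [L']

/-- The Gram kernel of a holomorphic map into an inner product space is sesquiholomorphic. -/
theorem isSesquiholomorphicOn_inner {H : Type*} [NormedAddCommGroup H] [InnerProductSpace ℂ H]
    {e : E → H} {W : Set E} (hW : IsOpen W) (he : DifferentiableOn ℂ e W) :
    IsSesquiholomorphicOn (fun z w => inner ℂ (e w) (e z)) W := by
  intro a b t h1 h2
  have hline : ∀ s : ℂ, a + s • b ∈ W → DifferentiableAt ℂ (fun s : ℂ => e (a + s • b)) s :=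
    fun s hs => (he.differentiableAt (hW.mem_nhds hs)).comp s (f := fun s : ℂ => a + s • b)
      (by fun_prop)
  exact (differentiableAt_antilinear_comp_conj (innerSL ℂ (E := H)) (hline _ h2)).clm_apply
    (hline t h1)

/-- The algebra of kernels of the form `∑ pₐ(z) conj (qₐ(w))` (a finite sum),
with `pₐ`, `qₐ` holomorphic on `W`. -/
def finiteRankKernels (W : Set E) : Subalgebra ℂ (E → E → ℂ) where
  carrier := {k | ∃ (ι : Type) (_ : Fintype ι) (p q : ι → E → ℂ),
    (∀ a, DifferentiableOn ℂ (p a) W) ∧ (∀ a, DifferentiableOn ℂ (q a) W) ∧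
    ∀ z w, k z w = ∑ a, p a z * conj (q a w)}
  mul_mem' := by
    rintro k k' ⟨ι, _, p, q, hp, hq, h⟩ ⟨ι', _, p', q', hp', hq', h'⟩
    refine ⟨ι × ι', inferInstance, fun a z => p a.1 z * p' a.2 z, fun a z => q a.1 z * q' a.2 z,
      fun a => (hp _).mul (hp' _), fun a => (hq _).mul (hq' _), fun z w => ?_⟩
    rw [Pi.mul_apply, Pi.mul_apply, h, h', Finset.sum_mul_sum, Fintype.sum_prod_type]
    refine Finset.sum_congr rfl fun a _ => Finset.sum_congr rfl fun b _ => ?_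
    rw [map_mul]; ring
  add_mem' := by
    rintro k k' ⟨ι, _, p, q, hp, hq, h⟩ ⟨ι', _, p', q', hp', hq', h'⟩
    refine ⟨ι ⊕ ι', inferInstance, Sum.elim p p', Sum.elim q q', ?_, ?_, fun z w => ?_⟩
    · rintro (a | a)
      exacts [hp a, hp' a]
    · rintro (a | a)
      exacts [hq a, hq' a]
    · simp [h, h']
  algebraMap_mem' := fun c => ⟨Unit, inferInstance, fun _ _ => c, fun _ _ => 1,
    fun _ => differentiableOn_const _, fun _ => differentiableOn_const _, fun z w => by simp⟩

theorem mul_conj_mem_finiteRankKernels {W : Set E} {p q : E → ℂ} (hp : DifferentiableOn ℂ p W)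
    (hq : DifferentiableOn ℂ q W) : (fun z w => p z * conj (q w)) ∈ finiteRankKernels W :=
  ⟨Unit, inferInstance, fun _ => p, fun _ => q, fun _ => hp, fun _ => hq, fun z w => by simp⟩

theorem isSesquiholomorphicOn_of_mem_finiteRankKernels {W : Set E} (hW : IsOpen W)
    {k : E → E → ℂ} (hk : k ∈ finiteRankKernels W) : IsSesquiholomorphicOn k W := by
  obtain ⟨ι, _, p, q, hp, hq, h⟩ := hk
  intro a b t h1 h2
  simp only [h]
  have hline : ∀ f : E → ℂ, DifferentiableOn ℂ f W → ∀ s : ℂ, a + s • b ∈ W →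
      DifferentiableAt ℂ (fun s : ℂ => f (a + s • b)) s :=
    fun f hf s hs => (hf.differentiableAt (hW.mem_nhds hs)).comp s
      (f := fun s : ℂ => a + s • b) (by fun_prop)
  refine DifferentiableAt.fun_sum fun i _ => ?_
  refine (hline _ (hp i) t h1).mul ?_
  have h2 := (hline _ (hq i) _ h2)
  have := DifferentiableAt.conj_conj h2
  simpa [Function.comp_def] using this

/-- The multiplicative monoid of kernels of the form `1 + ∑ pₐ(z) conj (pₐ(w))` (a finite sum). -/
def unitalPositiveKernels (E : Type*) : Submonoid (E → E → ℂ) where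
  carrier := {k | ∃ (ι : Type) (_ : Fintype ι) (p : ι → E → ℂ),
    ∀ z w, k z w = 1 + ∑ a, p a z * conj (p a w)}
  mul_mem' := by
    rintro k k' ⟨ι, _, p, h⟩ ⟨ι', _, p', h'⟩
    refine ⟨ι ⊕ ι' ⊕ ι × ι', inferInstance,
      Sum.elim p (Sum.elim p' fun a z => p a.1 z * p' a.2 z), fun z w => ?_⟩
    have : (∑ x, p x z * conj (p x w)) * (∑ x, p' x z * conj (p' x w)) =
        ∑ x : ι × ι', p x.1 z * p' x.2 z * (conj (p x.1 w) * conj (p' x.2 w)) := by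
      rw [Finset.sum_mul_sum, Fintype.sum_prod_type]
      exact Finset.sum_congr rfl fun a _ => Finset.sum_congr rfl fun b _ => by ring
    simp only [Pi.mul_apply, h, h', Fintype.sum_sum_type, Sum.elim_inl, Sum.elim_inr, map_mul,
      ← this]
    ring
  one_mem' := ⟨Empty, inferInstance, fun _ _ => 0, fun z w => by simp⟩

/-- The product of a positive definite Gram kernel of infinite rank with a kernel
`1 + ∑ pₐ(z) conj (pₐ(w))` is not of finite rank. -/
theorem not_mem_finiteRankKernels_of_linearIndependent {H : Type*} [NormedAddCommGroup H]
    [InnerProductSpace ℂ H] {e : E → H} {U W : Set E} {k h : E → E → ℂ}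
    (hind : ∀ n : ℕ, ∃ z : Fin n → E, (∀ i, z i ∈ U) ∧ LinearIndependent ℂ fun i => e (z i))
    (hh : h ∈ unitalPositiveKernels E) {c : ℂ} (hc : c ≠ 0)
    (heq : ∀ z ∈ U, ∀ w ∈ U, k z w = c * inner ℂ (e w) (e z) * h z w) :
    k ∉ finiteRankKernels W := by
  rintro ⟨ι, _, p, q, -, -, hk⟩
  obtain ⟨κ, _, g, hg⟩ := hh
  obtain ⟨z, hzU, hz⟩ := hind (Fintype.card ι + 1)
  obtain ⟨x, hx0, hx⟩ : ∃ x : Fin (Fintype.card ι + 1) → ℂ, x ≠ 0 ∧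
      ∀ a, ∑ i, x i * p a (z i) = 0 := by
    let L : (Fin (Fintype.card ι + 1) → ℂ) →ₗ[ℂ] (ι → ℂ) :=
      (Matrix.of fun a i => p a (z i)).mulVecLin
    have := LinearMap.ker_ne_bot_of_finrank_lt (f := L) (by simp)
    obtain ⟨x, hx, hx0⟩ := (Submodule.ne_bot_iff _).mp this
    refine ⟨x, hx0, fun a => ?_⟩
    have := congrFun (LinearMap.mem_ker.mp hx) a
    simpa [L, Matrix.mulVec, dotProduct, mul_comm] using this
  have hsum0 : ∑ i, ∑ j, x i * conj (x j) * k (z i) (z j) = 0 := by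
    have : ∀ i j, x i * conj (x j) * k (z i) (z j) =
        ∑ a, (x i * p a (z i)) * (conj (x j) * conj (q a (z j))) := by
      intro i j
      rw [hk, Finset.mul_sum]
      exact Finset.sum_congr rfl fun a _ => by ring
    simp_rw [this]
    rw [Finset.sum_congr rfl fun i _ => Finset.sum_comm, Finset.sum_comm]
    refine Finset.sum_eq_zero fun a _ => ?_
    simp_rw [← Finset.mul_sum, ← Finset.sum_mul, hx a, zero_mul]
  have hnorm : ∀ y : Fin (Fintype.card ι + 1) → ℂ,
      ((‖∑ i, y i • e (z i)‖ ^ 2 : ℝ) : ℂ) =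
        ∑ i, ∑ j, y i * conj (y j) * inner ℂ (e (z j)) (e (z i)) := by
    intro y
    rw [Complex.ofReal_pow]
    have := inner_self_eq_norm_sq_to_K (𝕜 := ℂ) (∑ i, y i • e (z i))
    erw [← this]
    simp only [inner_sum, sum_inner, inner_smul_left, inner_smul_right]
    refine Finset.sum_congr rfl fun i _ => ?_
    rw [Finset.mul_sum]
    exact Finset.sum_congr rfl fun j _ => by ring
  have hexp : ∑ i, ∑ j, x i * conj (x j) * k (z i) (z j) =
      c * ((‖∑ i, x i • e (z i)‖ ^ 2 +
        ∑ b, ‖∑ i, (x i * g b (z i)) • e (z i)‖ ^ 2 : ℝ) : ℂ) := by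
    rw [Complex.ofReal_add, Complex.ofReal_sum, hnorm]
    simp_rw [hnorm, map_mul]
    rw [mul_add, Finset.mul_sum, Finset.mul_sum]
    simp_rw [Finset.mul_sum]
    rw [Finset.sum_comm (s := (Finset.univ : Finset κ)), ← Finset.sum_add_distrib]
    refine Finset.sum_congr rfl fun i _ => ?_
    rw [Finset.sum_comm (s := (Finset.univ : Finset κ)), ← Finset.sum_add_distrib]
    refine Finset.sum_congr rfl fun j _ => ?_
    rw [heq _ (hzU i) _ (hzU j), hg, mul_add, mul_one, mul_add, Finset.mul_sum, Finset.mul_sum]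
    congr 1
    · ring
    · exact Finset.sum_congr rfl fun b _ => by ring
  rw [hsum0] at hexp
  have hpos : 0 < ‖∑ i, x i • e (z i)‖ ^ 2 +
        ∑ b, ‖∑ i, (x i * g b (z i)) • e (z i)‖ ^ 2 := by
    have : ∑ i, x i • e (z i) ≠ 0 := by
      intro h0
      exact hx0 (funext fun i => Fintype.linearIndependent_iff.mp hz x h0 i)
    positivity
  rcases mul_eq_zero.mp hexp.symm with h | h
  · exact hc h
  · exact hpos.ne' (by exact_mod_cast h)

end SesquiholomorphicKernels

section DualOfInnerProductSpace

open UniformSpace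

variable {A : Type*} [NormedAddCommGroup A] [InnerProductSpace ℂ A]

theorem StrongDual.parallelogram_law (φ ψ : StrongDual ℂ A) :
    ‖φ + ψ‖ * ‖φ + ψ‖ + ‖φ - ψ‖ * ‖φ - ψ‖ = 2 * (‖φ‖ * ‖φ‖ + ‖ψ‖ * ‖ψ‖) := by
  let ι : A →L[ℂ] Completion A := Completion.toComplL
  have hd : DenseRange ι := Completion.denseRange_coe
  have hu : IsUniformInducing ι := Completion.isUniformInducing_coe A
  have hι : ∀ x, ‖ι x‖ = ‖x‖ := fun x => Completion.norm_coe x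
  let ext : StrongDual ℂ A → StrongDual ℂ (Completion A) := fun χ => χ.extend ι
  have hext : ∀ χ x, ext χ (ι x) = χ x := fun χ x => χ.extend_eq hd hu x
  have huniq : ∀ {χ : StrongDual ℂ A} {η : StrongDual ℂ (Completion A)},
      (∀ x, η (ι x) = χ x) → ext χ = η := fun {χ η} h =>
    ContinuousLinearMap.extend_unique χ hd hu η (by ext x; exact h x)
  have hnorm : ∀ χ, ‖ext χ‖ = ‖χ‖ := by
    intro χ
    refine le_antisymm ?_ ?_
    · simpa using ContinuousLinearMap.opNorm_extend_le χ (e := ι) (N := 1) hd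
        fun x => by simp [hι]
    · refine χ.opNorm_le_bound (norm_nonneg (ext χ)) fun x => ?_
      rw [← hext, ← hι]
      exact (ext χ).le_opNorm _
  have hadd : ext (φ + ψ) = ext φ + ext ψ := huniq fun x => by simp [hext]
  have hsub : ext (φ - ψ) = ext φ - ext ψ := huniq fun x => by simp [hext]
  have := parallelogram_law_with_norm ℂ
    ((InnerProductSpace.toDual ℂ (Completion A)).symm (ext φ))
    ((InnerProductSpace.toDual ℂ (Completion A)).symm (ext ψ))
  simpa only [← map_add, ← map_sub, LinearIsometryEquiv.norm_map, ← hadd, ← hsub, hnorm, sq]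
    using this

end DualOfInnerProductSpace

section Bergman

open Metric MeasureTheory ENNReal

variable {m : ℕ}

theorem DifferentiableOn.prod_complex {ι E : Type*} [NormedAddCommGroup E] [NormedSpace ℂ E]
    {s : Finset ι} {f : ι → E → ℂ} {U : Set E} (h : ∀ i ∈ s, DifferentiableOn ℂ (f i) U) :
    DifferentiableOn ℂ (fun x => ∏ i ∈ s, f i x) U := by
  induction s using Finset.cons_induction with
  | empty => simp
  | cons a s ha ih =>
    simp only [Finset.prod_cons]
    exact (h a (by simp)).mul (ih fun i hi => h i (by simp [hi]))

/-- The mean value inequality for `‖f‖²`, with `f` holomorphic. -/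
theorem enorm_sq_mul_volume_ball_le {f : (Fin m → ℂ) → ℂ} {z : Fin m → ℂ} {r : ℝ}
    (hf : DifferentiableOn ℂ f (ball z r)) :
    ‖f z‖ₑ ^ 2 * volume (ball z r) ≤ ∫⁻ y in ball z r, ‖f y‖ₑ ^ 2 := by
  set g : (Fin m → ℂ) → ℝ≥0∞ := (ball z r).indicator fun y => ‖f y‖ₑ ^ 2 with hg
  have hgm : Measurable g := by
    have : Measurable ((ball z r).piecewise f 0) :=
      hf.continuousOn.measurable_piecewise continuousOn_const measurableSet_ball
    have h2 : g = fun y => ‖(ball z r).piecewise f 0 y‖ₑ ^ 2 := by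
      ext y
      by_cases hy : y ∈ ball z r <;> simp [hg, hy]
    rw [h2]
    exact this.enorm.pow_const 2
  set I : Set ℝ := Ioc 0 (2 * Real.pi) with hI
  have hIv : volume I = ENNReal.ofReal (2 * Real.pi) := by simp [hI]
  have hI0 : volume I ≠ 0 := by
    rw [hIv]; simp [Real.pi_pos]
  have hIt : volume I ≠ ∞ := by rw [hIv]; exact ofReal_ne_top
  -- rotations preserve the volume
  have hrot : ∀ θ : ℝ, ∫⁻ y in ball (0 : Fin m → ℂ) r, g (z + circleMap 0 1 θ • y) =
      ∫⁻ y in ball z r, ‖f y‖ₑ ^ 2 := by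
    intro θ
    have hc : ‖circleMap 0 1 θ‖ = 1 := by simp
    have hmp1 : MeasurePreserving (fun y : Fin m → ℂ => circleMap 0 1 θ • y) := by
      have h1 : MeasurePreserving (fun t : ℂ => circleMap 0 1 θ * t) := by
        exact (rotation (⟨circleMap 0 1 θ, by simp [Submonoid.unitSphere]⟩ :
          Circle)).measurePreserving
      exact volume_preserving_pi fun _ => h1
    have hmp : MeasurePreserving (fun y : Fin m → ℂ => z + circleMap 0 1 θ • y) :=
      (measurePreserving_add_left volume z).comp hmp1
    have hpre : (fun y : Fin m → ℂ => z + circleMap 0 1 θ • y) ⁻¹' ball z r = ball 0 r := by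
      ext y; simp [mem_ball, dist_eq_norm, norm_smul]
    have := hmp.setLIntegral_comp_preimage (measurableSet_ball (x := z) (ε := r)) hgm
    rw [hpre] at this
    rw [this]
    exact setLIntegral_congr_fun measurableSet_ball fun y hy => by simp [hg, hy]
  have hmean : ∀ y ∈ ball (0 : Fin m → ℂ) r,
      ‖f z‖ₑ ^ 2 * volume I ≤ ∫⁻ θ in I, g (z + circleMap 0 1 θ • y) := by
    intro y hy
    have hr : 0 < r := pos_of_mem_ball hy
    have hmem : ∀ t : ℂ, ‖t‖ ≤ 1 → z + t • y ∈ ball z r := by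
      intro t ht
      rw [mem_ball_zero_iff] at hy
      simp only [mem_ball, dist_eq_norm, add_sub_cancel_left, norm_smul]
      nlinarith [norm_nonneg y, norm_nonneg t]
    have hline : ∀ t : ℂ, ‖t‖ ≤ 1 → DifferentiableAt ℂ (fun t : ℂ => f (z + t • y) ^ 2) t := by
      intro t ht
      refine DifferentiableAt.pow ?_ 2
      exact (hf.differentiableAt (isOpen_ball.mem_nhds (hmem t ht))).comp t
        (f := fun t : ℂ => z + t • y) (by fun_prop)
    have hcl : DiffContOnCl ℂ (fun t : ℂ => f (z + t • y) ^ 2) (ball 0 |1|) := by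
      refine DifferentiableOn.diffContOnCl fun t ht => ?_
      rw [abs_one, closure_ball _ one_ne_zero, mem_closedBall_zero_iff] at ht
      exact (hline t ht).differentiableWithinAt
    have hav := hcl.circleAverage
    rw [Real.circleAverage_def, inv_smul_eq_iff₀ (by positivity),
      intervalIntegral.integral_of_le (by positivity)] at hav
    have hle := enorm_integral_le_lintegral_enorm (μ := volume.restrict I)
      (fun θ : ℝ => f (z + circleMap 0 1 θ • y) ^ 2)
    rw [hav] at hle
    calc ‖f z‖ₑ ^ 2 * volume I = ‖(2 * Real.pi) • (f (z + (0 : ℂ) • y) ^ 2)‖ₑ := by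
          rw [hIv, enorm_smul, zero_smul, add_zero, enorm_pow, mul_comm,
            Real.enorm_of_nonneg (by positivity)]
      _ ≤ _ := hle
      _ = ∫⁻ θ in I, g (z + circleMap 0 1 θ • y) := by
          refine lintegral_congr fun θ => ?_
          have : z + circleMap 0 1 θ • y ∈ ball z r := hmem _ (by simp)
          simp [hg, this, enorm_pow]
  have htotal : ‖f z‖ₑ ^ 2 * volume (ball z r) * volume I ≤
      (∫⁻ y in ball z r, ‖f y‖ₑ ^ 2) * volume I := by
    calc ‖f z‖ₑ ^ 2 * volume (ball z r) * volume I
        = ∫⁻ y in ball (0 : Fin m → ℂ) r, ‖f z‖ₑ ^ 2 * volume I := by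
          rw [setLIntegral_const, Measure.addHaar_ball_center]; ring
      _ ≤ ∫⁻ y in ball (0 : Fin m → ℂ) r, ∫⁻ θ in I, g (z + circleMap 0 1 θ • y) :=
          setLIntegral_mono' measurableSet_ball hmean
      _ = ∫⁻ θ in I, ∫⁻ y in ball (0 : Fin m → ℂ) r, g (z + circleMap 0 1 θ • y) := by
          refine lintegral_lintegral_swap (Measurable.aemeasurable ?_)
          exact hgm.comp (by fun_prop)
      _ = _ := by
          simp_rw [hrot]
          rw [setLIntegral_const]
  exact (ENNReal.mul_le_mul_iff_left hI0 hIt).mp htotal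

/-- The classes of square integrable functions with a holomorphic representative. -/
def bergmanSubmodule (D : Set (Fin m → ℂ)) : Submodule ℂ (Lp ℂ 2 (volume.restrict D)) where
  carrier := {g | ∃ f, DifferentiableOn ℂ f D ∧ g =ᵐ[volume.restrict D] f}
  add_mem' := by
    rintro g g' ⟨f, hf, h⟩ ⟨f', hf', h'⟩
    exact ⟨f + f', hf.add hf', (Lp.coeFn_add g g').trans (h.add h')⟩
  zero_mem' := ⟨0, differentiableOn_const 0, Lp.coeFn_zero _ _ _⟩
  smul_mem' := by
    rintro c g ⟨f, hf, h⟩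
    exact ⟨c • f, hf.const_smul c, (Lp.coeFn_smul c g).trans (h.const_smul c)⟩

/-- The Bergman space of `D`. -/
def BergmanSpace (D : Set (Fin m → ℂ)) : Type := bergmanSubmodule D

instance (D : Set (Fin m → ℂ)) : NormedAddCommGroup (BergmanSpace D) :=
  inferInstanceAs (NormedAddCommGroup (bergmanSubmodule D))

instance (D : Set (Fin m → ℂ)) : InnerProductSpace ℂ (BergmanSpace D) :=
  inferInstanceAs (InnerProductSpace ℂ (bergmanSubmodule D))

/-- The class of an element of the Bergman space. -/
def BergmanSpace.toLp {D : Set (Fin m → ℂ)} (g : BergmanSpace D) : Lp ℂ 2 (volume.restrict D) :=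
  Subtype.val (p := (· ∈ bergmanSubmodule D)) g

/-- The holomorphic representative of an element of the Bergman space. -/
def bergmanFun {D : Set (Fin m → ℂ)} (g : BergmanSpace D) : (Fin m → ℂ) → ℂ :=
  (Subtype.property (p := (· ∈ bergmanSubmodule D)) g).choose

variable {D : Set (Fin m → ℂ)}

theorem differentiableOn_bergmanFun (g : BergmanSpace D) :
    DifferentiableOn ℂ (bergmanFun g) D :=
  (Subtype.property (p := (· ∈ bergmanSubmodule D)) g).choose_spec.1

theorem bergmanFun_ae_eq (g : BergmanSpace D) :
    g.toLp =ᵐ[volume.restrict D] bergmanFun g :=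
  (Subtype.property (p := (· ∈ bergmanSubmodule D)) g).choose_spec.2

theorem eqOn_bergmanFun (hD : IsOpen D) {g : BergmanSpace D} {f : (Fin m → ℂ) → ℂ}
    (hf : DifferentiableOn ℂ f D)
    (h : g.toLp =ᵐ[volume.restrict D] f) :
    EqOn (bergmanFun g) f D :=
  Measure.eqOn_open_of_ae_eq ((bergmanFun_ae_eq g).symm.trans h) hD
    (differentiableOn_bergmanFun g).continuousOn hf.continuousOn

theorem eqOn_bergmanFun_add (hD : IsOpen D) (g g' : BergmanSpace D) :
    EqOn (bergmanFun (g + g')) (bergmanFun g + bergmanFun g') D :=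
  eqOn_bergmanFun hD ((differentiableOn_bergmanFun g).add (differentiableOn_bergmanFun g'))
    ((Lp.coeFn_add g.toLp g'.toLp).trans ((bergmanFun_ae_eq g).add (bergmanFun_ae_eq g')))

theorem eqOn_bergmanFun_smul (hD : IsOpen D) (c : ℂ) (g : BergmanSpace D) :
    EqOn (bergmanFun (c • g)) (c • bergmanFun g) D :=
  eqOn_bergmanFun hD ((differentiableOn_bergmanFun g).const_smul c)
    ((Lp.coeFn_smul c g.toLp).trans ((bergmanFun_ae_eq g).const_smul c))

theorem enorm_sq_bergmanFun (g : BergmanSpace D) :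
    ‖g‖ₑ ^ 2 = ∫⁻ y in D, ‖bergmanFun g y‖ₑ ^ 2 := by
  have h1 : ‖g‖ₑ = eLpNorm (bergmanFun g) 2 (volume.restrict D) := by
    rw [← eLpNorm_congr_ae (bergmanFun_ae_eq g), ← Lp.enorm_def]
    rfl
  rw [h1, eLpNorm_eq_lintegral_rpow_enorm_toReal (by norm_num) (by norm_num)]
  simp only [ENNReal.toReal_ofNat, one_div]
  rw [← ENNReal.rpow_natCast, ← ENNReal.rpow_mul]
  simp

theorem exists_bergmanFun_eq (hD : IsOpen D) {f : (Fin m → ℂ) → ℂ} (hf : DifferentiableOn ℂ f D)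
    (hfin : ∫⁻ y in D, ‖f y‖ₑ ^ 2 ≠ ∞) : ∃ g : BergmanSpace D, EqOn (bergmanFun g) f D := by
  have hmem : MemLp f 2 (volume.restrict D) := by
    refine ⟨hf.continuousOn.aestronglyMeasurable hD.measurableSet, ?_⟩
    rw [eLpNorm_eq_lintegral_rpow_enorm_toReal (by norm_num) (by norm_num)]
    simp only [ENNReal.toReal_ofNat, one_div]
    refine ENNReal.rpow_lt_top_of_nonneg (by norm_num) ?_
    convert hfin with y
    simp
  exact ⟨⟨hmem.toLp f, f, hf, hmem.coeFn_toLp⟩, eqOn_bergmanFun hD hf hmem.coeFn_toLp⟩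

theorem exists_norm_bergmanFun_le {r : ℝ} (hr : 0 < r) : ∃ C : ℝ, 0 ≤ C ∧
    ∀ z : Fin m → ℂ, ball z r ⊆ D → ∀ g : BergmanSpace D, ‖bergmanFun g z‖ ≤ C * ‖g‖ := by
  set V := volume (ball (0 : Fin m → ℂ) r)
  have hV0 : V ≠ 0 := (measure_ball_pos _ _ hr).ne'
  have hVt : V ≠ ∞ := measure_ball_lt_top.ne
  have hV : 0 < V.toReal := ENNReal.toReal_pos hV0 hVt
  refine ⟨(Real.sqrt V.toReal)⁻¹, by positivity, fun z hz g => ?_⟩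
  have h1 : ‖bergmanFun g z‖ₑ ^ 2 * V ≤ ‖g‖ₑ ^ 2 := by
    rw [enorm_sq_bergmanFun]
    calc _ = ‖bergmanFun g z‖ₑ ^ 2 * volume (ball z r) := by
          rw [Measure.addHaar_ball_center]
      _ ≤ ∫⁻ y in ball z r, ‖bergmanFun g y‖ₑ ^ 2 :=
          enorm_sq_mul_volume_ball_le ((differentiableOn_bergmanFun g).mono hz)
      _ ≤ _ := lintegral_mono_set hz
  have h2 : ‖bergmanFun g z‖ ^ 2 * V.toReal ≤ ‖g‖ ^ 2 := by
    have := ENNReal.toReal_mono (by finiteness) h1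
    simpa using this
  have h3 : ‖bergmanFun g z‖ * Real.sqrt V.toReal ≤ ‖g‖ := by
    refine le_of_sq_le_sq ?_ (norm_nonneg _)
    rw [mul_pow, Real.sq_sqrt hV.le]
    exact h2
  rw [inv_mul_eq_div, le_div_iff₀ (Real.sqrt_pos.mpr hV)]
  exact h3

/-- Evaluation of holomorphic square integrable functions at a point, as a bounded functional. -/
theorem exists_bergmanEval (hD : IsOpen D) (z : Fin m → ℂ) :
    ∃ φ : StrongDual ℂ (BergmanSpace D), z ∈ D → ∀ g, φ g = bergmanFun g z := by
  by_cases hz : z ∈ D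
  · obtain ⟨r, hr, hball⟩ := Metric.isOpen_iff.mp hD z hz
    obtain ⟨C, -, hC⟩ := exists_norm_bergmanFun_le (D := D) hr
    let ℓ : BergmanSpace D →ₗ[ℂ] ℂ :=
      { toFun := fun g => bergmanFun g z
        map_add' := fun g g' => eqOn_bergmanFun_add hD g g' hz
        map_smul' := fun c g => eqOn_bergmanFun_smul hD c g hz }
    exact ⟨ℓ.mkContinuous C fun g => hC z hball g, fun _ _ => rfl⟩
  · exact ⟨0, fun h => absurd h hz⟩

theorem differentiableOn_bergmanEval (hD : IsOpen D)
    {e : (Fin m → ℂ) → StrongDual ℂ (BergmanSpace D)}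
    (he : ∀ z ∈ D, ∀ g, e z g = bergmanFun g z) : DifferentiableOn ℂ e D := by
  intro x hx
  obtain ⟨s, hs, hball⟩ := Metric.isOpen_iff.mp hD x hx
  set r := s / 2
  have hr : 0 < r := by positivity
  obtain ⟨C, hC0, hC⟩ := exists_norm_bergmanFun_le (D := D) hr
  have hsub : ∀ z ∈ ball x r, ball z r ⊆ D := fun z hz =>
    (ball_subset_ball' (by rw [mem_ball] at hz; simp only [r] at *; linarith)).trans hball
  have hxD : ball x r ⊆ D := fun z hz => hsub z hz (mem_ball_self hr)
  have hbd : ∀ g, ∀ z ∈ ball x r, ‖bergmanFun g z‖ ≤ C * ‖g‖ := fun g z hz =>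
    hC z (hsub z hz) g
  have hdiff : ∀ g : BergmanSpace D, DifferentiableAt ℂ (bergmanFun g) x := fun g =>
    (differentiableOn_bergmanFun g).differentiableAt (hD.mem_nhds hx)
  let B : (Fin m → ℂ) →ₗ[ℂ] BergmanSpace D →ₗ[ℂ] ℂ :=
    LinearMap.mk₂ ℂ (fun h g => fderiv ℂ (bergmanFun g) x h)
      (fun h h' g => by simp) (fun c h g => by simp)
      (fun h g g' => by
        have : fderiv ℂ (bergmanFun (g + g')) x =
            fderiv ℂ (bergmanFun g + bergmanFun g') x :=
          ((eqOn_bergmanFun_add hD g g').eventuallyEq_of_mem (hD.mem_nhds hx)).fderiv_eq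
        rw [this, fderiv_add (hdiff g) (hdiff g')]; rfl)
      (fun c h g => by
        have : fderiv ℂ (bergmanFun (c • g)) x = fderiv ℂ (c • bergmanFun g) x :=
          ((eqOn_bergmanFun_smul hD c g).eventuallyEq_of_mem (hD.mem_nhds hx)).fderiv_eq
        rw [this, fderiv_const_smul (hdiff g)]; rfl)
  let e' : (Fin m → ℂ) →L[ℂ] StrongDual ℂ (BergmanSpace D) :=
    B.mkContinuous₂ (2 * C / r) fun h g => by
      have h1 := norm_fderiv_le_of_norm_le_on_ball hr
        ((differentiableOn_bergmanFun g).mono hxD) (hbd g)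
      calc ‖fderiv ℂ (bergmanFun g) x h‖ ≤ ‖fderiv ℂ (bergmanFun g) x‖ * ‖h‖ :=
            ContinuousLinearMap.le_opNorm _ _
        _ ≤ (2 * (C * ‖g‖) / r) * ‖h‖ := by gcongr
        _ = 2 * C / r * ‖h‖ * ‖g‖ := by ring
  have hO : (fun z => e z - e x - e' (z - x)) =O[nhds x] fun z => ‖z - x‖ ^ 2 := by
    refine Asymptotics.IsBigO.of_bound (4 * C / r ^ 2) ?_
    filter_upwards [ball_mem_nhds x hr] with z hz
    refine ContinuousLinearMap.opNorm_le_bound _ (by positivity) fun g => ?_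
    have h1 := norm_sub_sub_fderiv_le_of_norm_le_on_ball
      ((differentiableOn_bergmanFun g).mono hxD) (hbd g) hz
    have h2 : (e z - e x - e' (z - x)) g =
        bergmanFun g z - bergmanFun g x - fderiv ℂ (bergmanFun g) x (z - x) := by
      rw [sub_apply, sub_apply, he z (hxD hz), he x hx]
      rfl
    rw [h2]
    refine h1.trans_eq ?_
    rw [norm_pow, norm_norm]
    ring
  have hd : HasFDerivAt e e' x :=
    .of_isLittleO (hO.trans_isLittleO (Asymptotics.isLittleO_pow_sub_sub x one_lt_two))
  exact hd.differentiableAt.differentiableWithinAt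

/-- Lagrange interpolation shows that evaluations at points with distinct `l`-th coordinates
are linearly independent. -/
theorem linearIndependent_bergmanEval (hD : IsOpen D) (hb : Bornology.IsBounded D)
    {e : (Fin m → ℂ) → StrongDual ℂ (BergmanSpace D)}
    (he : ∀ z ∈ D, ∀ g, e z g = bergmanFun g z) {n : ℕ} {z : Fin n → Fin m → ℂ}
    (hz : ∀ i, z i ∈ D) {l : Fin m} (hinj : Function.Injective fun i => z i l) :
    LinearIndependent ℂ fun i => e (z i) := by
  rw [Fintype.linearIndependent_iff]
  intro x hx i
  let f : (Fin m → ℂ) → ℂ := fun w => ∏ j ∈ Finset.univ.erase i, (w l - z j l)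
  have hfd : Differentiable ℂ f := by
    rw [← differentiableOn_univ]
    exact DifferentiableOn.prod_complex fun j _ => by fun_prop
  obtain ⟨C, hC⟩ := hb.isCompact_closure.exists_bound_of_continuousOn hfd.continuous.continuousOn
  obtain ⟨g, hg⟩ := exists_bergmanFun_eq hD (f := f) hfd.differentiableOn (by
    refine ne_top_of_le_ne_top (b := ENNReal.ofReal C ^ 2 * volume D)
      (ENNReal.mul_ne_top (by finiteness) hb.measure_lt_top.ne) ?_
    rw [← setLIntegral_const]
    refine setLIntegral_mono' hD.measurableSet fun y hy => ?_
    gcongr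
    rw [← ofReal_norm]
    exact ENNReal.ofReal_le_ofReal (hC y (subset_closure hy)))
  have h1 := congrArg (fun φ : StrongDual ℂ (BergmanSpace D) => φ g) hx
  have h2 : ∀ j, e (z j) g = f (z j) := fun j => (he _ (hz j) g).trans (hg (hz j))
  have h3 : ∑ j, x j * f (z j) = 0 := by
    simpa [sum_apply, h2] using h1
  rw [Finset.sum_eq_single i] at h3
  · refine (mul_eq_zero.mp h3).resolve_right (Finset.prod_ne_zero_iff.mpr fun j hj => ?_)
    exact sub_ne_zero.mpr fun h => (Finset.ne_of_mem_erase hj) (hinj h.symm)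
  · intro j _ hj
    rw [show f (z j) = 0 from Finset.prod_eq_zero (Finset.mem_erase.mpr ⟨hj, Finset.mem_univ j⟩)
      (sub_self _), mul_zero]
  · simp

theorem det_fderiv_eq {σ : (Fin m → ℂ) → Fin m → ℂ} {z : Fin m → ℂ}
    (hσ : DifferentiableAt ℂ σ z) : (fderiv ℂ σ z).det =
      (Matrix.of fun i l => fderiv ℂ (fun w => σ w i) z (Pi.single l 1)).det := by
  rw [ContinuousLinearMap.det, ← LinearMap.det_toMatrix']
  congr 1
  ext i l
  rw [LinearMap.toMatrix'_apply, Matrix.of_apply, fderiv_pi (differentiableAt_pi.mp hσ)]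
  simp [Pi.single]

theorem differentiableOn_det_fderiv (hD : IsOpen D) {σ : (Fin m → ℂ) → Fin m → ℂ}
    (hσ : DifferentiableOn ℂ σ D) : DifferentiableOn ℂ (fun z => (fderiv ℂ σ z).det) D := by
  refine DifferentiableOn.congr ?_ fun z hz =>
    det_fderiv_eq (hσ.differentiableAt (hD.mem_nhds hz))
  simp only [Matrix.det_apply, Matrix.of_apply]
  refine DifferentiableOn.fun_sum fun π _ => DifferentiableOn.const_smul ?_ _
  refine DifferentiableOn.prod_complex fun i _ => ?_
  exact differentiableOn_fderiv_apply hD (differentiableOn_pi.mp hσ _) _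

theorem ofReal_abs_det_restrictScalars (L : (Fin m → ℂ) →L[ℂ] Fin m → ℂ) :
    ENNReal.ofReal |(L.restrictScalars ℝ).det| = ‖L.det‖ₑ ^ 2 := by
  have h : (L.restrictScalars ℝ).det = Algebra.norm ℝ L.det :=
    LinearMap.det_restrictScalars (f := (L : (Fin m → ℂ) →ₗ[ℂ] Fin m → ℂ))
  rw [h, Algebra.norm_complex_apply, Complex.normSq_eq_norm_sq, abs_of_nonneg (by positivity),
    ENNReal.ofReal_pow (norm_nonneg _), ofReal_norm]

theorem det_fderiv_mul_det_fderiv_of_involution (hD : IsOpen D) {σ : (Fin m → ℂ) → Fin m → ℂ}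
    (hσ : DifferentiableOn ℂ σ D) (hmaps : MapsTo σ D D) (hinv : ∀ z ∈ D, σ (σ z) = z)
    {z : Fin m → ℂ} (hz : z ∈ D) : (fderiv ℂ σ (σ z)).det * (fderiv ℂ σ z).det = 1 := by
  have h1 := hσ.differentiableAt (hD.mem_nhds hz)
  have h2 := hσ.differentiableAt (hD.mem_nhds (hmaps hz))
  have h3 : (fderiv ℂ σ (σ z)).comp (fderiv ℂ σ z) = ContinuousLinearMap.id ℂ _ := by
    rw [← fderiv_comp z h2 h1, ← fderiv_id (x := z)]
    refine Filter.EventuallyEq.fderiv_eq ?_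
    filter_upwards [hD.mem_nhds hz] with w hw using hinv w hw
  have h4 := congrArg ContinuousLinearMap.det h3
  rw [ContinuousLinearMap.det, ContinuousLinearMap.toLinearMap_comp, LinearMap.det_comp] at h4
  rw [ContinuousLinearMap.det, ContinuousLinearMap.det, h4]
  simp [ContinuousLinearMap.det]

/-- The transformation law of the Bergman kernel under holomorphic involutions. -/
theorem norm_bergmanEval_eq (hD : IsOpen D)
    {e : (Fin m → ℂ) → StrongDual ℂ (BergmanSpace D)}
    (he : ∀ z ∈ D, ∀ g, e z g = bergmanFun g z) {σ : (Fin m → ℂ) → Fin m → ℂ}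
    (hσ : DifferentiableOn ℂ σ D) (hmaps : MapsTo σ D D) (hinv : ∀ z ∈ D, σ (σ z) = z)
    {z : Fin m → ℂ} (hz : z ∈ D) : ‖e z‖ = ‖(fderiv ℂ σ z).det‖ * ‖e (σ z)‖ := by
  have himg : σ '' D = D := Subset.antisymm hmaps.image_subset
    fun w hw => ⟨σ w, hmaps hw, hinv w hw⟩
  have hinj : InjOn σ D := fun a ha b hb hab => by rw [← hinv a ha, ← hinv b hb, hab]
  have hle : ∀ w ∈ D, ‖(fderiv ℂ σ w).det‖ * ‖e (σ w)‖ ≤ ‖e w‖ := by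
    intro w hw
    have hbound : ‖(fderiv ℂ σ w).det • e (σ w)‖ ≤ ‖e w‖ := by
      refine ContinuousLinearMap.opNorm_le_bound _ (norm_nonneg (e w)) fun g => ?_
      have hnorm : ∫⁻ y in D, ‖(fderiv ℂ σ y).det * bergmanFun g (σ y)‖ₑ ^ 2 = ‖g‖ₑ ^ 2 := by
        have h1 := lintegral_image_eq_lintegral_abs_det_fderiv_mul volume hD.measurableSet
          (f' := fun y => (fderiv ℂ σ y).restrictScalars ℝ)
          (fun y hy => ((hσ.differentiableAt
            (hD.mem_nhds hy)).hasFDerivAt.restrictScalars ℝ).hasFDerivWithinAt)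
          hinj (fun y => ‖bergmanFun g y‖ₑ ^ 2)
        rw [himg, ← enorm_sq_bergmanFun] at h1
        rw [h1]
        refine lintegral_congr fun y => ?_
        rw [ofReal_abs_det_restrictScalars, enorm_mul, mul_pow]
      obtain ⟨g', hg'⟩ := exists_bergmanFun_eq hD
        (f := fun y => (fderiv ℂ σ y).det * bergmanFun g (σ y))
        ((differentiableOn_det_fderiv hD hσ).mul
          ((differentiableOn_bergmanFun g).comp hσ hmaps)) (by rw [hnorm]; finiteness)
      have hgg : ‖g'‖ = ‖g‖ := by
        have : ‖g'‖ₑ ^ 2 = ‖g‖ₑ ^ 2 := by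
          rw [enorm_sq_bergmanFun, ← hnorm]
          exact setLIntegral_congr_fun hD.measurableSet fun y hy => by rw [hg' hy]
        have h2 := congrArg ENNReal.toReal this
        simp only [ENNReal.toReal_pow, toReal_enorm] at h2
        exact (sq_eq_sq₀ (norm_nonneg _) (norm_nonneg _)).mp h2
      have h3 : ((fderiv ℂ σ w).det • e (σ w)) g = e w g' := by
        rw [he w hw, hg' hw, smul_apply, he _ (hmaps hw), smul_eq_mul]
      rw [h3, ← hgg]
      exact (e w).le_opNorm _
    rwa [norm_smul] at hbound
  refine le_antisymm ?_ (hle z hz)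
  have h1 := hle _ (hmaps hz)
  rw [hinv z hz] at h1
  have h2 := congrArg norm (det_fderiv_mul_det_fderiv_of_involution hD hσ hmaps hinv hz)
  rw [norm_mul, norm_one] at h2
  calc ‖e z‖ = ‖(fderiv ℂ σ z).det‖ * (‖(fderiv ℂ σ (σ z)).det‖ * ‖e z‖) := by
        linear_combination (-‖e z‖) * h2
    _ ≤ _ := by gcongr

/-- The Bergman kernel of a bounded domain `D`, in the form of a holomorphic map `e` into an
inner product space whose Gram kernel is the Bergman kernel. -/
theorem exists_bergmanKernel (hD : IsOpen D) (hb : Bornology.IsBounded D) :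
    ∃ (H : Type) (_ : NormedAddCommGroup H) (_ : InnerProductSpace ℂ H) (e : (Fin m → ℂ) → H),
      DifferentiableOn ℂ e D ∧
      (∀ (n : ℕ) (z : Fin n → Fin m → ℂ), (∀ i, z i ∈ D) →
        ∀ l : Fin m, (Function.Injective fun i => z i l) →
          LinearIndependent ℂ fun i => e (z i)) ∧
      ∀ σ : (Fin m → ℂ) → Fin m → ℂ, DifferentiableOn ℂ σ D → MapsTo σ D D →
        (∀ z ∈ D, σ (σ z) = z) → ∀ z ∈ D, ‖e z‖ = ‖(fderiv ℂ σ z).det‖ * ‖e (σ z)‖ := by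
  choose e he using exists_bergmanEval hD
  exact ⟨StrongDual ℂ (BergmanSpace D), inferInstance,
    InnerProductSpace.ofNorm ℂ StrongDual.parallelogram_law, e,
    differentiableOn_bergmanEval hD he,
    fun n z hz l hinj => linearIndependent_bergmanEval hD hb he hz hinj,
    fun σ hσ hmaps hinv z hz => norm_bergmanEval_eq hD he hσ hmaps hinv hz⟩

end Bergman

section Symmetry

open Filter Topology

variable {m : ℕ} {D : Set (Fin m → ℂ)}

theorem hasStrictFDerivAt_of_differentiableOn_complex (hD : IsOpen D)
    {σ : (Fin m → ℂ) → Fin m → ℂ} (hσ : DifferentiableOn ℂ σ D) {x : Fin m → ℂ} (hx : x ∈ D) :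
    HasStrictFDerivAt σ (fderiv ℂ σ x) x := by
  refine hasStrictFDerivAt_of_hasFDerivAt_of_continuousAt (f' := fderiv ℂ σ) ?_ ?_
  · filter_upwards [hD.mem_nhds hx] with y hy
    exact (hσ.differentiableAt (hD.mem_nhds hy)).hasFDerivAt
  · refine ContinuousOn.continuousAt (continuousOn_clm_apply.mpr fun v => ?_) (hD.mem_nhds hx)
    refine continuousOn_pi.mpr fun i => ?_
    refine ((differentiableOn_fderiv_apply hD (differentiableOn_pi.mp hσ i) v).continuousOn).congr
      fun y hy => ?_
    rw [fderiv_pi (differentiableAt_pi.mp (hσ.differentiableAt (hD.mem_nhds hy)))]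
    rfl

/-- The derivative of a holomorphic involution at an isolated fixed point is `-1`. -/
theorem fderiv_apply_eq_neg_of_isolated_fixedPoint (hD : IsOpen D)
    {σ : (Fin m → ℂ) → Fin m → ℂ} (hσ : DifferentiableOn ℂ σ D)
    (hinv : ∀ z ∈ D, σ (σ z) = z) {x : Fin m → ℂ} (hx : x ∈ D) (hfix : σ x = x)
    (hiso : ∃ ε > 0, ∀ y ∈ D, dist y x < ε → σ y = y → y = x) (v : Fin m → ℂ) :
    fderiv ℂ σ x v = -v := by
  obtain ⟨ε, hε, hiso⟩ := hiso
  have hs := hasStrictFDerivAt_of_differentiableOn_complex hD hσ hx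
  set A := fderiv ℂ σ x with hA
  have hd := hs.hasFDerivAt
  have hAA : ∀ v, A (A v) = v := by
    have h1 : HasFDerivAt (σ ∘ σ) (A.comp A) x := by
      refine HasFDerivAt.comp x ?_ hd
      rwa [hfix]
    have h2 : HasFDerivAt (σ ∘ σ) (ContinuousLinearMap.id ℂ (Fin m → ℂ)) x := by
      refine (hasFDerivAt_id x).congr_of_eventuallyEq ?_
      filter_upwards [hD.mem_nhds hx] with z hz using hinv z hz
    exact fun v => congrArg (fun L : (Fin m → ℂ) →L[ℂ] Fin m → ℂ => L v) (h1.unique h2)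
  let φ : (Fin m → ℂ) → Fin m → ℂ := fun z => (2⁻¹ : ℂ) • ((z - x) + A (σ z - x))
  have hφ : HasStrictFDerivAt φ
      ((ContinuousLinearEquiv.refl ℂ (Fin m → ℂ) : (Fin m → ℂ) →L[ℂ] Fin m → ℂ)) x := by
    have h := (((hasStrictFDerivAt_id x).sub_const x).add
      (A.hasStrictFDerivAt.comp x (hs.sub_const x))).const_smul (2⁻¹ : ℂ)
    refine h.congr_fderiv ?_
    ext1 v
    simp only [ContinuousLinearEquiv.coe_coe, ContinuousLinearEquiv.refl_apply, smul_apply,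
      add_apply, ContinuousLinearMap.comp_apply, ContinuousLinearMap.id_apply, hAA]
    rw [← two_smul ℂ v, smul_smul]
    norm_num
  have hφσ : ∀ z ∈ D, φ (σ z) = A (φ z) := by
    intro z hz
    simp only [φ, hinv z hz, map_smul, map_add, hAA]
    rw [add_comm]
  have hφx : φ x = 0 := by simp [φ, hfix]
  have key : ∀ v, A v = v → v = 0 := by
    intro v hv
    have hψ : Tendsto (fun t : ℂ => hφ.localInverse φ _ x (t • v)) (𝓝 0) (𝓝 x) := by
      have h1 : Tendsto (fun t : ℂ => t • v) (𝓝 0) (𝓝 (φ x)) := by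
        rw [hφx]
        exact (continuous_id.smul continuous_const).tendsto' _ _ (zero_smul ℂ v)
      have h2 := hφ.localInverse_continuousAt.tendsto.comp h1
      rwa [hφ.localInverse_apply_image] at h2
    have hright : ∀ᶠ t : ℂ in 𝓝 0, φ (hφ.localInverse φ _ x (t • v)) = t • v := by
      have h1 : Tendsto (fun t : ℂ => t • v) (𝓝 0) (𝓝 (φ x)) := by
        rw [hφx]
        exact (continuous_id.smul continuous_const).tendsto' _ _ (zero_smul ℂ v)
      exact h1.eventually hφ.eventually_right_inverse
    have hσx : Tendsto σ (𝓝 x) (𝓝 x) := by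
      have := hd.continuousAt.tendsto
      rwa [hfix] at this
    have hfixed : ∀ᶠ t : ℂ in 𝓝 0, t • v = 0 := by
      filter_upwards [hright, hψ.eventually (hD.mem_nhds hx),
        hψ.eventually (Metric.ball_mem_nhds x hε),
        hψ.eventually hφ.eventually_left_inverse,
        (hσx.comp hψ).eventually hφ.eventually_left_inverse] with t h1 h2 h3 h4 h5
      have h6 : σ (hφ.localInverse φ _ x (t • v)) = hφ.localInverse φ _ x (t • v) := by
        rw [Function.comp_apply, hφσ _ h2, h1, map_smul, hv] at h5
        exact h5.symm
      rw [← h1, hiso _ h2 h3 h6, hφx]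
    obtain ⟨t, ht, ht0⟩ := (hfixed.filter_mono nhdsWithin_le_nhds |>.and
      (self_mem_nhdsWithin : {0}ᶜ ∈ 𝓝[≠] (0 : ℂ))).exists
    exact (smul_eq_zero.mp ht).resolve_left ht0
  have h := key (v + A v) (by rw [map_add, hAA, add_comm])
  exact eq_neg_of_add_eq_zero_right h

end Symmetry

section CanonicalMetric

open Filter Topology Matrix

variable {m : ℕ}

theorem pullbackMetric_eq {ι : Type*} [Fintype ι] (g : (ι → ℂ) → Matrix ι ι ℂ)
    (F : (Fin m → ℂ) → ι → ℂ) (w : Fin m → ℂ) :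
    pullbackMetric g F w =
      ((Matrix.of (Jac F w)).map (starRingEnd ℂ))ᴴ * g (F w) *
        (Matrix.of (Jac F w)).map (starRingEnd ℂ) := by
  ext l k
  simp only [pullbackMetric, Matrix.mul_apply, Matrix.of_apply, Matrix.conjTranspose_apply,
    Matrix.map_apply, Finset.sum_mul, RCLike.star_def, Complex.conj_conj]
  rw [Finset.sum_comm]
  refine Finset.sum_congr rfl fun j _ => Finset.sum_congr rfl fun i _ => ?_
  ring

theorem det_pullbackMetric (g : (Fin m → ℂ) → Matrix (Fin m) (Fin m) ℂ)
    {σ : (Fin m → ℂ) → Fin m → ℂ} {z : Fin m → ℂ} (hσ : DifferentiableAt ℂ σ z) :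
    (pullbackMetric g σ z).det = (‖(fderiv ℂ σ z).det‖ ^ 2 : ℝ) * (g (σ z)).det := by
  have h : (Matrix.of (Jac σ z)).det = (fderiv ℂ σ z).det := (det_fderiv_eq hσ).symm
  have h2 : ((Matrix.of (Jac σ z)).map (starRingEnd ℂ)).det =
      (starRingEnd ℂ) (fderiv ℂ σ z).det := by
    rw [← h, RingHom.map_det]; rfl
  rw [pullbackMetric_eq, Matrix.det_mul, Matrix.det_mul, Matrix.det_conjTranspose, h2,
    RCLike.star_def, Complex.conj_conj, ← Complex.normSq_eq_norm_sq, ← Complex.mul_conj]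
  ring

/-- The determinant of a canonical metric on a bounded symmetric domain is a constant multiple
of any kernel with the transformation law of the Bergman kernel. -/
theorem exists_det_eq_mul_norm_sq {D : Set (Fin m → ℂ)} (hD : IsBddSymmDomain D)
    {G : HermMetricOn D} (hG : IsCanonicalKahlerMetric D G)
    {H : Type} [NormedAddCommGroup H] [InnerProductSpace ℂ H] {e : (Fin m → ℂ) → H}
    (he : DifferentiableOn ℂ e D) (hne : ∀ z ∈ D, e z ≠ 0)
    (htrans : ∀ σ : (Fin m → ℂ) → Fin m → ℂ, DifferentiableOn ℂ σ D → MapsTo σ D D →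
      (∀ z ∈ D, σ (σ z) = z) → ∀ z ∈ D, ‖e z‖ = ‖(fderiv ℂ σ z).det‖ * ‖e (σ z)‖) :
    ∃ C : ℝ, 0 < C ∧ ∀ z ∈ D, (G.g z).det = ((C * ‖e z‖ ^ 2 : ℝ) : ℂ) := by
  set u : (Fin m → ℂ) → ℝ := fun z => (G.g z).det.re / ‖e z‖ ^ 2 with hu
  have hsq : ∀ z ∈ D, ‖e z‖ ^ 2 ≠ 0 := fun z hz => pow_ne_zero 2 (norm_ne_zero_iff.mpr (hne z hz))
  have hdetpos : ∀ z ∈ D, 0 < (G.g z).det.re ∧ (G.g z).det = ((G.g z).det.re : ℂ) := by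
    intro z hz
    have h := (G.posDef z hz).det_pos
    rw [Complex.lt_def] at h
    exact ⟨by simpa using h.1, Complex.ext rfl (by simpa using h.2.symm)⟩
  have hud : DifferentiableOn ℝ u D := by
    have h1 : ContDiffOn ℝ (⊤ : ℕ∞) (fun z => (G.g z).det) D := by
      simp only [Matrix.det_apply']
      exact ContDiffOn.sum fun π _ =>
        contDiffOn_const.mul (contDiffOn_prod fun i _ => G.smooth _ _)
    have h2 : DifferentiableOn ℝ (fun z => (G.g z).det.re) D :=
      Complex.reCLM.differentiable.comp_differentiableOn (h1.differentiableOn (by simp))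
    have h3 : DifferentiableOn ℝ (fun z => ‖e z‖ ^ 2) D := (he.restrictScalars ℝ).norm_sq ℂ
    exact h2.fun_mul (h3.inv hsq)
  have hinv : ∀ σ : (Fin m → ℂ) → Fin m → ℂ, DifferentiableOn ℂ σ D → MapsTo σ D D →
      (∀ z ∈ D, σ (σ z) = z) → ∀ z ∈ D, u (σ z) = u z := by
    intro σ hσ hmaps hσσ z hz
    have h1 := hG.2 σ hσ hmaps ⟨σ, hσ, hmaps, hσσ, hσσ⟩ z hz
    have h2 := congrArg Matrix.det h1
    rw [det_pullbackMetric _ (hσ.differentiableAt (hD.isOpen.mem_nhds hz))] at h2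
    have h3 : (G.g z).det.re = ‖(fderiv ℂ σ z).det‖ ^ 2 * (G.g (σ z)).det.re := by
      rw [← h2, Complex.re_ofReal_mul]
    have h4 : ‖e z‖ = ‖(fderiv ℂ σ z).det‖ * ‖e (σ z)‖ := htrans σ hσ hmaps hσσ z hz
    have h5 : ‖(fderiv ℂ σ z).det‖ ≠ 0 := by
      intro h0
      rw [h0, zero_mul, norm_eq_zero] at h4
      exact hne z hz h4
    simp only [hu]
    rw [h3, h4, mul_pow, mul_div_mul_left _ _ (pow_ne_zero 2 h5)]
  have hfd : EqOn (fderiv ℝ u) 0 D := by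
    intro x hx
    obtain ⟨σ, hσ, hmaps, hσσ, hfix, hiso⟩ := hD.symm x hx
    have hA := fderiv_apply_eq_neg_of_isolated_fixedPoint hD.isOpen hσ hσσ hx hfix hiso
    have hd : HasFDerivAt u (fderiv ℝ u x) x :=
      (hud.differentiableAt (hD.isOpen.mem_nhds hx)).hasFDerivAt
    have hdσ : HasFDerivAt σ ((fderiv ℂ σ x).restrictScalars ℝ) x :=
      (hσ.differentiableAt (hD.isOpen.mem_nhds hx)).hasFDerivAt.restrictScalars ℝ
    have h1 : HasFDerivAt (u ∘ σ) ((fderiv ℝ u x).comp ((fderiv ℂ σ x).restrictScalars ℝ)) x := by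
      refine HasFDerivAt.comp x ?_ hdσ
      rwa [hfix]
    have h2 : HasFDerivAt (u ∘ σ) (fderiv ℝ u x) x := by
      refine hd.congr_of_eventuallyEq ?_
      filter_upwards [hD.isOpen.mem_nhds hx] with z hz using hinv σ hσ hmaps hσσ z hz
    ext1 v
    have h3 := congrArg (fun L : (Fin m → ℂ) →L[ℝ] ℝ => L v) (h1.unique h2)
    simp only [ContinuousLinearMap.comp_apply, ContinuousLinearMap.coe_restrictScalars', hA,
      map_neg] at h3
    rw [Pi.zero_apply, _root_.zero_apply]
    linarith
  obtain ⟨C, hC⟩ := hD.isOpen.exists_is_const_of_fderiv_eq_zero hD.isConnected.isPreconnected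
    hud hfd
  obtain ⟨x, hx⟩ := hD.isConnected.nonempty
  have hpos : ∀ z ∈ D, 0 < ‖e z‖ ^ 2 := fun z hz => lt_of_le_of_ne (by positivity) (hsq z hz).symm
  refine ⟨C, ?_, fun z hz => ?_⟩
  · rw [← hC x hx]
    exact div_pos (hdetpos x hx).1 (hpos x hx)
  · rw [(hdetpos z hz).2, ← hC z hz, div_mul_cancel₀ _ (hsq z hz)]

end CanonicalMetric

section FubiniStudy

open Matrix ComplexConjugate

variable {m l : ℕ}

theorem pullbackMetric_prodFS (N : Fin l → ℕ) (μ : Fin l → ℝ)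
    (F : (Fin m → ℂ) → (Σ j, Fin (N j)) → ℂ) (w : Fin m → ℂ) :
    pullbackMetric (prodFS N μ) F w =
      ∑ j, (μ j : ℂ) • pullbackMetric (fubiniStudy (N j)) (fun w a => F w ⟨j, a⟩) w := by
  ext i k
  simp only [pullbackMetric, Matrix.of_apply, Matrix.sum_apply, Matrix.smul_apply, smul_eq_mul,
    Fintype.sum_sigma, Finset.mul_sum]
  refine Finset.sum_congr rfl fun j _ => Finset.sum_congr rfl fun a _ => ?_
  rw [Finset.sum_eq_single j]
  · refine Finset.sum_congr rfl fun b _ => ?_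
    simp only [prodFS, Matrix.of_apply, dite_true, Fin.cast_eq_self, mul_assoc]
    rfl
  · intro j' _ hj'
    refine Finset.sum_eq_zero fun b _ => ?_
    simp [prodFS, hj'.symm]
  · simp

theorem posSemidef_fubiniStudy (N : ℕ) (z : Fin N → ℂ) : (fubiniStudy N z).PosSemidef := by
  set s : ℝ := ∑ a, Complex.normSq (z a) with hs
  have hs0 : 0 ≤ s := Finset.sum_nonneg fun a _ => Complex.normSq_nonneg _
  have hM : fubiniStudy N z =
      ((((1 + s) ^ 2)⁻¹ : ℝ) : ℂ) • (((1 + s : ℝ) : ℂ) • (1 : Matrix (Fin N) (Fin N) ℂ) -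
        vecMulVec (star z) z) := by
    ext i j
    simp only [fubiniStudy, ← hs, Matrix.of_apply, Matrix.smul_apply, Matrix.sub_apply,
      Matrix.one_apply, vecMulVec_apply, Pi.star_apply, smul_eq_mul, RCLike.star_def]
    push_cast
    rw [div_eq_inv_mul]
  rw [hM]
  refine PosSemidef.smul (PosSemidef.of_dotProduct_mulVec_nonneg ?_ fun x => ?_)
    (Complex.zero_le_real.mpr (by positivity))
  · ext i j
    simp [vecMulVec_apply, Matrix.one_apply, mul_comm, eq_comm]
    split_ifs <;> simp
  · have h1 : star x ⬝ᵥ (((1 + s : ℝ) : ℂ) • (1 : Matrix (Fin N) (Fin N) ℂ) -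
        vecMulVec (star z) z) *ᵥ x =
        (((1 + s) * ∑ a, ‖x a‖ ^ 2 - ‖∑ a, z a * x a‖ ^ 2 : ℝ) : ℂ) := by
      rw [sub_mulVec, smul_mulVec, one_mulVec, vecMulVec_mulVec, dotProduct_sub, dotProduct_smul]
      have h2 : star x ⬝ᵥ x = ((∑ a, ‖x a‖ ^ 2 : ℝ) : ℂ) := by
        simp only [dotProduct, Pi.star_apply, RCLike.star_def]
        push_cast
        exact Finset.sum_congr rfl fun a _ => Complex.conj_mul' _
      have h3 : star x ⬝ᵥ star z = conj (∑ a, z a * x a) := by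
        simp [dotProduct, mul_comm]
      rw [h2, dotProduct_smul, h3]
      push_cast
      rw [← Complex.conj_mul']
      simp [dotProduct, mul_comm]
    rw [h1]
    refine Complex.zero_le_real.mpr ?_
    have h2 : ‖∑ a, z a * x a‖ ≤ ∑ a, ‖z a‖ * ‖x a‖ :=
      (norm_sum_le _ _).trans_eq (by simp)
    have h3 := Finset.sum_mul_sq_le_sq_mul_sq Finset.univ (fun a => ‖z a‖) fun a => ‖x a‖
    have h4 : s = ∑ a, ‖z a‖ ^ 2 := by simp [hs, Complex.normSq_eq_norm_sq]
    have h5 : 0 ≤ ∑ a, ‖x a‖ ^ 2 := by positivity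
    have h6 := pow_le_pow_left₀ (norm_nonneg _) h2 2
    rw [← h4] at h3
    linarith

theorem posSemidef_pullbackMetric_prodFS (N : Fin l → ℕ) {μ : Fin l → ℝ} (hμ : ∀ j, 0 < μ j)
    (F : (Fin m → ℂ) → (Σ j, Fin (N j)) → ℂ) (w : Fin m → ℂ) :
    (pullbackMetric (prodFS N μ) F w).PosSemidef := by
  rw [pullbackMetric_prodFS]
  refine posSemidef_sum _ fun j _ => PosSemidef.smul ?_ (Complex.zero_le_real.mpr (hμ j).le)
  rw [pullbackMetric_eq]
  exact (posSemidef_fubiniStudy _ _).conjTranspose_mul_mul_same _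

/-- The polarization of `1 + ‖f‖²`. -/
def affineKernel {n : ℕ} (f : (Fin m → ℂ) → Fin n → ℂ) : (Fin m → ℂ) → (Fin m → ℂ) → ℂ :=
  fun z w => 1 + ∑ a, f z a * conj (f w a)

theorem affineKernel_self_ne_zero {n : ℕ} (f : (Fin m → ℂ) → Fin n → ℂ) (z : Fin m → ℂ) :
    affineKernel f z z ≠ 0 := by
  have h : affineKernel f z z = ((1 + ∑ a, ‖f z a‖ ^ 2 : ℝ) : ℂ) := by
    simp [affineKernel, Complex.mul_conj']
  rw [h, Complex.ofReal_ne_zero]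
  positivity

/-- The polarization of the coefficients of the pullback of the Fubini–Study metric, multiplied
by `(1 + ‖f‖²)²`. -/
def fubiniStudyNumerator {n : ℕ} (f : (Fin m → ℂ) → Fin n → ℂ) (i k : Fin m) :
    (Fin m → ℂ) → (Fin m → ℂ) → ℂ :=
  fun z w => affineKernel f z w * ∑ a, Jac f z a i * conj (Jac f w a k) -
    (∑ a, Jac f z a i * conj (f w a)) * ∑ a, f z a * conj (Jac f w a k)

theorem sq_affineKernel_mul_pullbackMetric {n : ℕ} (f : (Fin m → ℂ) → Fin n → ℂ) (i k : Fin m)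
    (z : Fin m → ℂ) :
    affineKernel f z z ^ 2 * pullbackMetric (fubiniStudy n) f z i k =
      fubiniStudyNumerator f i k z z := by
  have hs : (1 + ((∑ a, Complex.normSq (f z a) : ℝ) : ℂ)) = affineKernel f z z := by
    simp [affineKernel, Complex.mul_conj]
  have hs0 := affineKernel_self_ne_zero f z
  simp only [pullbackMetric, fubiniStudy, Matrix.of_apply, hs, fubiniStudyNumerator,
    Finset.mul_sum, Finset.sum_mul]
  have h1 : ∀ a b, affineKernel f z z ^ 2 * ((affineKernel f z z * (if a = b then 1 else 0) -
      conj (f z a) * f z b) / affineKernel f z z ^ 2 * Jac f z a i * conj (Jac f z b k)) =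
      (if a = b then affineKernel f z z * (Jac f z a i * conj (Jac f z b k)) else 0) -
      Jac f z a i * conj (f z a) * (f z b * conj (Jac f z b k)) := by
    intro a b
    split_ifs <;> field_simp
    ring
  simp only [h1, Finset.sum_sub_distrib, Finset.sum_ite_eq, Finset.mem_univ, if_true]
  congr 1
  exact Finset.sum_comm

variable {W : Set (Fin m → ℂ)}

theorem affineKernel_mem_unitalPositiveKernels {n : ℕ} (f : (Fin m → ℂ) → Fin n → ℂ) :
    affineKernel f ∈ unitalPositiveKernels (Fin m → ℂ) :=
  ⟨Fin n, inferInstance, fun a z => f z a, fun _ _ => rfl⟩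

theorem sum_mul_conj_mem_finiteRankKernels {ι : Type*} [Fintype ι]
    {p q : ι → (Fin m → ℂ) → ℂ} (hp : ∀ a, DifferentiableOn ℂ (p a) W)
    (hq : ∀ a, DifferentiableOn ℂ (q a) W) :
    (fun z w => ∑ a, p a z * conj (q a w)) ∈ finiteRankKernels W := by
  have h := Subalgebra.sum_mem (finiteRankKernels W) (t := Finset.univ) fun a _ =>
    mul_conj_mem_finiteRankKernels (hp a) (hq a)
  convert h using 1
  ext z w
  simp [Finset.sum_apply]

theorem affineKernel_mem_finiteRankKernels {n : ℕ} {f : (Fin m → ℂ) → Fin n → ℂ}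
    (hf : ∀ a, DifferentiableOn ℂ (fun z => f z a) W) : affineKernel f ∈ finiteRankKernels W :=
  Subalgebra.add_mem _ (Subalgebra.one_mem _) (sum_mul_conj_mem_finiteRankKernels hf hf)

theorem fubiniStudyNumerator_mem_finiteRankKernels (hW : IsOpen W) {n : ℕ}
    {f : (Fin m → ℂ) → Fin n → ℂ} (hf : ∀ a, DifferentiableOn ℂ (fun z => f z a) W)
    (i k : Fin m) : fubiniStudyNumerator f i k ∈ finiteRankKernels W := by
  have hJ : ∀ i a, DifferentiableOn ℂ (fun z => Jac f z a i) W := fun i a =>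
    differentiableOn_fderiv_apply hW (hf a) _
  exact Subalgebra.sub_mem _
    (Subalgebra.mul_mem _ (affineKernel_mem_finiteRankKernels hf)
      (sum_mul_conj_mem_finiteRankKernels (hJ i) (hJ k)))
    (Subalgebra.mul_mem _ (sum_mul_conj_mem_finiteRankKernels (hJ i) hf)
      (sum_mul_conj_mem_finiteRankKernels hf (hJ k)))

/-- The determinant of the pullback of a product of Fubini–Study metrics is, up to the factor
`∏ⱼ (1 + ‖Fʲ‖²)^(2m)`, a kernel of finite rank. -/
theorem exists_det_pullbackMetric_prodFS (hW : IsOpen W) (N : Fin l → ℕ) (μ : Fin l → ℝ)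
    {F : (Fin m → ℂ) → (Σ j, Fin (N j)) → ℂ} (hF : DifferentiableOn ℂ F W) :
    ∃ h ∈ unitalPositiveKernels (Fin m → ℂ), h ∈ finiteRankKernels W ∧
      ∃ P ∈ finiteRankKernels W,
        ∀ z, P z z = h z z * (pullbackMetric (prodFS N μ) F z).det := by
  let f : ∀ j, (Fin m → ℂ) → Fin (N j) → ℂ := fun j z a => F z ⟨j, a⟩
  have hf : ∀ j a, DifferentiableOn ℂ (fun z => f j z a) W := fun j a =>
    differentiableOn_pi.mp hF ⟨j, a⟩
  let s : (Fin m → ℂ) → (Fin m → ℂ) → ℂ := ∏ j, affineKernel (f j) ^ 2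
  let A : Matrix (Fin m) (Fin m) ((Fin m → ℂ) → (Fin m → ℂ) → ℂ) := Matrix.of fun i k =>
    ∑ j, (μ j : ℂ) • (fubiniStudyNumerator (f j) i k *
      ∏ j' ∈ Finset.univ.erase j, affineKernel (f j') ^ 2)
  have hAe : ∀ i k, A i k = ∑ j, (μ j : ℂ) • (fubiniStudyNumerator (f j) i k *
      ∏ j' ∈ Finset.univ.erase j, affineKernel (f j') ^ 2) := fun _ _ => rfl
  have hA : ∀ i k, A i k ∈ finiteRankKernels W := by
    intro i k
    rw [hAe]
    refine Subalgebra.sum_mem _ fun j _ => Subalgebra.smul_mem _ (Subalgebra.mul_mem _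
      (fubiniStudyNumerator_mem_finiteRankKernels hW (hf j) i k)
      (Subalgebra.prod_mem _ fun j' _ => Subalgebra.pow_mem _
        (affineKernel_mem_finiteRankKernels (hf j')) 2)) _
  refine ⟨s ^ m, ?_, ?_, A.det, ?_, fun z => ?_⟩
  · exact Submonoid.pow_mem _ (Submonoid.prod_mem _ fun j _ => Submonoid.pow_mem _
      (affineKernel_mem_unitalPositiveKernels _) 2) m
  · exact Subalgebra.pow_mem _ (Subalgebra.prod_mem _ fun j _ => Subalgebra.pow_mem _
      (affineKernel_mem_finiteRankKernels (hf j)) 2) m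
  · rw [Matrix.det_apply]
    refine Subalgebra.sum_mem _ fun π _ => ?_
    rw [Units.smul_def]
    exact zsmul_mem (Subalgebra.prod_mem _ fun i _ => hA _ _) _
  · let ev : ((Fin m → ℂ) → (Fin m → ℂ) → ℂ) →+* ℂ :=
      (Pi.evalRingHom (fun _ : Fin m → ℂ => ℂ) z).comp
        (Pi.evalRingHom (fun _ : Fin m → ℂ => (Fin m → ℂ) → ℂ) z)
    have hev : ∀ k, ev k = k z z := fun _ => rfl
    have h1 : A.map ev = s z z • pullbackMetric (prodFS N μ) F z := by
      ext i k
      rw [pullbackMetric_prodFS, Matrix.map_apply, Matrix.smul_apply, Matrix.sum_apply,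
        Finset.smul_sum, ← hev s, hAe, map_sum]
      refine Finset.sum_congr rfl fun j _ => ?_
      have h2 : s = affineKernel (f j) ^ 2 *
          ∏ j' ∈ Finset.univ.erase j, affineKernel (f j') ^ 2 :=
        (Finset.mul_prod_erase _ _ (Finset.mem_univ j)).symm
      rw [h2, map_mul, map_pow, hev (affineKernel (f j)), Matrix.smul_apply, smul_eq_mul,
        smul_eq_mul]
      change (μ j : ℂ) * ev (_ * _) = _
      rw [map_mul, hev (fubiniStudyNumerator _ _ _), ← sq_affineKernel_mul_pullbackMetric]
      ring
    have h2 := congrArg Matrix.det h1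
    rw [Matrix.det_smul, Fintype.card_fin] at h2
    exact (RingHom.map_det ev A).trans h2

end FubiniStudy

/-!
STATEMENT 17: non-existence of germs of holomorphic maps `F : (D; x₀) → (X; F(x₀))` with
`F^*ω_X^p = λ ω_D^p`, where `D ⋐ ℂ^m` is a bounded symmetric domain with a canonical Kähler
form and `(X, g_X)` is a projective manifold isometrically embedded in
`(ℙ^{N₁}, μ₁ g_{FS}) × ⋯ × (ℙ^{N_l}, μ_l g_{FS})`.  Composing the germ with the isometric
embedding and choosing affine charts around the image point, such a germ is exactly a germ of
holomorphic map into the product of affine charts, carrying the product Fubini–Study metric,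
that preserves the p-th exterior powers up to λ — and no such germ exists.
-/
theorem stmt17 {m l : ℕ} (hm : 0 < m) (hl : 0 < l)
    (N : Fin l → ℕ) (μ : Fin l → ℝ) (hμ : ∀ j, 0 < μ j)
    (D : Set (Fin m → ℂ)) (hD : IsBddSymmDomain D)
    (G : HermMetricOn D) (hG : IsCanonicalKahlerMetric D G)
    (x₀ : Fin m → ℂ) (hx₀ : x₀ ∈ D)
    (p : ℕ) (hp : 1 ≤ p) (hpm : p ≤ m) (hpn : p ≤ ∑ j, N j)
    (lam : ℝ) (hlam : 0 < lam) :
    ¬ ∃ (W : Set (Fin m → ℂ)) (F : (Fin m → ℂ) → ((Σ j, Fin (N j)) → ℂ)),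
        IsOpen W ∧ x₀ ∈ W ∧ W ⊆ D ∧ DifferentiableOn ℂ F W ∧
        PreservesPP G.g (prodFS N μ) F W p lam := by
  rintro ⟨W, F, hWo, hx₀W, hWD, hF, hPP⟩
  obtain ⟨H, _, _, e, he, hind, htrans⟩ := exists_bergmanKernel hD.isOpen hD.isBounded
  have hne : ∀ z ∈ D, e z ≠ 0 := fun z hz =>
    (hind 1 (fun _ => z) (fun _ => hz) ⟨0, hm⟩ fun _ _ _ => Subsingleton.elim _ _).ne_zero 0
  obtain ⟨C, hC, hGdet⟩ := exists_det_eq_mul_norm_sq hD hG he hne htrans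
  obtain ⟨c, hc, hdet⟩ := exists_det_eq_mul_det_of_minors hp hpm hlam
  obtain ⟨h, hh, hhW, P, hP, hPdet⟩ := exists_det_pullbackMetric_prodFS hWo N μ hF
  obtain ⟨ε, hε, hball⟩ := Metric.isOpen_iff.mp hWo x₀ hx₀W
  set r : ℝ := ε / 3 with hr
  have hr0 : 0 < r := by positivity
  have hball3 : Metric.ball x₀ (3 * r) ⊆ W := by
    rwa [hr, mul_div_cancel₀ _ (by norm_num : (3 : ℝ) ≠ 0)]
  have hballr : Metric.ball x₀ r ⊆ W :=
    (Metric.ball_subset_ball (by linarith)).trans hball3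
  have hcC : ((c * C : ℝ) : ℂ) ≠ 0 := Complex.ofReal_ne_zero.mpr (by positivity)
  have hk : IsSesquiholomorphicOn
      (fun z w => P z w - inner ℂ (e w) (e z) * (((c * C : ℝ) : ℂ) • h) z w) W :=
    (isSesquiholomorphicOn_of_mem_finiteRankKernels hWo hP).sub
      ((isSesquiholomorphicOn_inner hWo (he.mono hWD)).mul
        (isSesquiholomorphicOn_of_mem_finiteRankKernels hWo (Subalgebra.smul_mem _ hhW _)))
  have hdiag : ∀ z ∈ W,
      P z z - inner ℂ (e z) (e z) * (((c * C : ℝ) : ℂ) • h) z z = 0 := by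
    intro z hz
    rw [hPdet, hdet _ _ (posSemidef_pullbackMetric_prodFS N hμ F z) (G.posDef z (hWD hz))
      (hPP z hz), hGdet z (hWD hz), inner_self_eq_norm_sq_to_K, Pi.smul_apply, Pi.smul_apply,
      smul_eq_mul]
    push_cast
    simp only [Complex.coe_algebraMap]
    ring
  refine not_mem_finiteRankKernels_of_linearIndependent (U := Metric.ball x₀ r) (e := e)
    (fun n => ?_) hh hcC (fun z hz w hw => ?_) hP
  · have hmem : ∀ i : Fin n,
        x₀ + ((r * (i / (n + 1)) : ℝ) : ℂ) • Pi.single (⟨0, hm⟩ : Fin m) (1 : ℂ) ∈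
          Metric.ball x₀ r := by
      intro i
      have hi : (i : ℝ) < n + 1 := by exact_mod_cast i.2.trans (Nat.lt_succ_self n)
      have h1 : (i : ℝ) / (n + 1) < 1 := (div_lt_one (by positivity)).mpr hi
      rw [Metric.mem_ball, dist_eq_norm, add_sub_cancel_left, norm_smul, Complex.norm_real,
        Real.norm_of_nonneg (by positivity), Pi.norm_single, norm_one, mul_one]
      exact mul_lt_of_lt_one_right hr0 h1
    refine ⟨_, hmem, hind n _ (fun i => hWD (hballr (hmem i))) ⟨0, hm⟩ fun i j hij => ?_⟩
    have h2 : r * ((i : ℝ) / (n + 1)) = r * ((j : ℝ) / (n + 1)) := by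
      simpa only [Pi.add_apply, Pi.smul_apply, Pi.single_eq_same, smul_eq_mul, mul_one,
        add_right_inj, Complex.ofReal_inj] using hij
    have h3 := (div_left_inj' (by positivity : (n : ℝ) + 1 ≠ 0)).mp (mul_left_cancel₀ hr0.ne' h2)
    exact Fin.ext (by exact_mod_cast h3)
  · have hkb : IsSesquiholomorphicOn
        (fun z w => P z w - inner ℂ (e w) (e z) * (((c * C : ℝ) : ℂ) • h) z w)
        (Metric.ball x₀ (3 * r)) :=
      fun a b t h1 h2 => hk a b t (hball3 h1) (hball3 h2)
    have h0 := hkb.eq_zero_of_diagonal (fun z hz => hdiag z (hball3 hz)) hz hw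
    rw [sub_eq_zero.mp h0, Pi.smul_apply, Pi.smul_apply, smul_eq_mul]
    ring
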